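/- arXiv:2307.09240 — 6 statements merged into one kernel-verified Lean document; each statement's English description precedes it below -/
import Mathlib

section
/- Let E be a real inner product space and for x ∈ E set W(x) = √(1 + ‖x‖²). Then for all x, y ∈ E one has ⟨x/W(x) − y/W(y), x − y⟩ = (1/2)·(W(x) + W(y))·( ‖x/W(x) − y/W(y)‖² + (1/W(x) − 1/W(y))² ). In particular ⟨x/W(x) − y/W(y), x − y⟩ ≥ 0, with equality if and only if x = y. -/
open scoped RealInnerProductSpace

/-- Pointwise content of the factorization lemma for Killing graphs (Lemma 2.2):
for `W x = √(1 + ‖x‖²)` in a real inner product space,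
`⟨x/W x − y/W y, x − y⟩ = ½ (W x + W y)(‖x/W x − y/W y‖² + (1/W x − 1/W y)²) ≥ 0`,
with equality iff `x = y`. -/
theorem factorization_lemma_pointwise {E : Type*} [NormedAddCommGroup E]
    [InnerProductSpace ℝ E] (W : E → ℝ)
    (hW : ∀ x, W x = Real.sqrt (1 + ‖x‖ ^ 2)) (x y : E) :
    ⟪(W x)⁻¹ • x - (W y)⁻¹ • y, x - y⟫ =
      (1 / 2) * (W x + W y) *
        (‖(W x)⁻¹ • x - (W y)⁻¹ • y‖ ^ 2 + ((W x)⁻¹ - (W y)⁻¹) ^ 2) ∧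
    0 ≤ ⟪(W x)⁻¹ • x - (W y)⁻¹ • y, x - y⟫ ∧
    (⟪(W x)⁻¹ • x - (W y)⁻¹ • y, x - y⟫ = 0 ↔ x = y) := by
  have pos (z : E) : 0 < W z := by rw [hW]; positivity
  have norm_sq (z : E) : ‖z‖ ^ 2 = W z ^ 2 - 1 := by
    rw [hW, Real.sq_sqrt (by positivity)]; ring
  have hx := pos x
  have hy := pos y
  have factorization : ⟪(W x)⁻¹ • x - (W y)⁻¹ • y, x - y⟫ =
      (1 / 2) * (W x + W y) *
        (‖(W x)⁻¹ • x - (W y)⁻¹ • y‖ ^ 2 + ((W x)⁻¹ - (W y)⁻¹) ^ 2) := by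
    rw [← real_inner_self_eq_norm_sq]
    simp only [inner_sub_left, inner_sub_right, real_inner_smul_left, real_inner_smul_right]
    simp only [real_inner_self_eq_norm_sq, norm_sq, real_inner_comm x y]
    field_simp
    ring
  refine ⟨factorization, by rw [factorization]; positivity, fun h => ?_, fun h => by simp [h]⟩
  rw [factorization, mul_eq_zero_iff_left (by positivity),
    add_eq_zero_iff_of_nonneg (by positivity) (by positivity)] at h
  have hinv : (W x)⁻¹ = (W y)⁻¹ := sub_eq_zero.mp (pow_eq_zero_iff two_ne_zero |>.mp h.2)
  have hsmul := sub_eq_zero.mp (norm_eq_zero.mp (pow_eq_zero_iff two_ne_zero |>.mp h.1))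
  rw [hinv] at hsmul
  exact smul_right_injective E (inv_ne_zero hy.ne') hsmul
end

section
/- Let r₀ < r₁ be real numbers, A > 0 and a > 0. Let φ: [r₀, r₁] → ℝ be continuous with φ ≥ 0, and let η: [r₀, r₁] → ℝ be continuous and satisfy η(r) ≥ A/a + (1/a)∫_{r₀}^{r} φ(s)η(s)² ds for every r ∈ [r₀, r₁]. Then ∫_{r₀}^{r₁} φ(s) ds < 2a²/A. -/
/-- The primitive of a function continuous on `[a, b]` has the expected derivative at every
interior point. -/
theorem hasDerivAt_primitive_of_continuousOn_Icc {f : ℝ → ℝ} {a b x : ℝ}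
    (hf : ContinuousOn f (Set.Icc a b)) (hx : x ∈ Set.Ioo a b) :
    HasDerivAt (fun r => ∫ s in a..r, f s) (f x) x := by
  have hint : IntervalIntegrable f MeasureTheory.volume a x := by
    apply ContinuousOn.intervalIntegrable
    rw [Set.uIcc_of_le hx.1.le]
    exact hf.mono (Set.Icc_subset_Icc_right hx.2.le)
  have hmeas : StronglyMeasurableAtFilter f (nhds x) MeasureTheory.volume :=
    (hf.mono Set.Ioo_subset_Icc_self).stronglyMeasurableAtFilter isOpen_Ioo x hx
  exact intervalIntegral.integral_hasDerivAt_right hint hmeas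
    (hf.continuousAt (Icc_mem_nhds hx.1 hx.2))

/-- The primitive of a function continuous on `[a, b]` is continuous on `[a, b]`. -/
theorem continuousOn_primitive_of_continuousOn_Icc {f : ℝ → ℝ} {a b : ℝ} (hab : a ≤ b)
    (hf : ContinuousOn f (Set.Icc a b)) :
    ContinuousOn (fun r => ∫ s in a..r, f s) (Set.Icc a b) := by
  rw [← Set.uIcc_of_le hab]
  apply intervalIntegral.continuousOn_primitive_interval
  rw [Set.uIcc_of_le hab]
  exact hf.integrableOn_Icc


/-- Chaplygin-type integral comparison lemma used in the proof of the Collin–Krust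
estimates: if `η(r) ≥ A/a + (1/a)∫_{r₀}^r φ η²` on `[r₀, r₁]` with `φ ≥ 0`
continuous and `A, a > 0`, then `∫_{r₀}^{r₁} φ < 2a²/A`. -/
theorem chaplygin_integral_comparison (r₀ r₁ : ℝ) (hr : r₀ < r₁) (A a : ℝ)
    (hA : 0 < A) (ha : 0 < a) (φ η : ℝ → ℝ)
    (hφc : ContinuousOn φ (Set.Icc r₀ r₁))
    (hφ0 : ∀ r ∈ Set.Icc r₀ r₁, 0 ≤ φ r)
    (hηc : ContinuousOn η (Set.Icc r₀ r₁))
    (hη : ∀ r ∈ Set.Icc r₀ r₁,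
      A / a + (1 / a) * ∫ s in r₀..r, φ s * η s ^ 2 ≤ η r) :
    (∫ s in r₀..r₁, φ s) < 2 * a ^ 2 / A := by
  have hψc : ContinuousOn (fun s => φ s * η s ^ 2) (Set.Icc r₀ r₁) := hφc.mul (hηc.pow 2)
  set F : ℝ → ℝ := fun r => A / a + (1 / a) * ∫ s in r₀..r, φ s * η s ^ 2 with hF
  have hFpos : ∀ r ∈ Set.Icc r₀ r₁, 0 < F r := by
    intro r hr'
    have hI : 0 ≤ ∫ s in r₀..r, φ s * η s ^ 2 :=
      intervalIntegral.integral_nonneg hr'.1 fun s hs =>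
        mul_nonneg (hφ0 s ⟨hs.1, hs.2.trans hr'.2⟩) (sq_nonneg _)
    simp only [hF]
    positivity
  have hFc : ContinuousOn F (Set.Icc r₀ r₁) :=
    continuousOn_const.add
      (continuousOn_const.mul (continuousOn_primitive_of_continuousOn_Icc hr.le hψc))
  have hmono : MonotoneOn (fun r => -(F r)⁻¹ - (1 / a) * ∫ s in r₀..r, φ s)
      (Set.Icc r₀ r₁) := by
    apply monotoneOn_of_hasDerivWithinAt_nonneg (convex_Icc r₀ r₁)
      (f' := fun x => -(-((1 / a) * (φ x * η x ^ 2)) / F x ^ 2) - (1 / a) * φ x)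
    · exact (hFc.inv₀ fun x hx => (hFpos x hx).ne').neg.sub
        (continuousOn_const.mul (continuousOn_primitive_of_continuousOn_Icc hr.le hφc))
    · intro x hx
      rw [interior_Icc] at hx
      have hFd : HasDerivAt F ((1 / a) * (φ x * η x ^ 2)) x :=
        ((hasDerivAt_primitive_of_continuousOn_Icc hψc hx).const_mul (1 / a)).const_add (A / a)
      exact ((hFd.fun_inv (hFpos x (Set.Ioo_subset_Icc_self hx)).ne').fun_neg.fun_sub
        ((hasDerivAt_primitive_of_continuousOn_Icc hφc hx).const_mul (1 / a))).hasDerivWithinAt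
    · intro x hx
      have hx' := interior_subset hx
      have hp := hFpos x hx'
      have hsq : F x ^ 2 ≤ η x ^ 2 := pow_le_pow_left₀ hp.le (hη x hx') 2
      have hc : 0 ≤ (1 / a) * φ x := mul_nonneg (by positivity) (hφ0 x hx')
      have key : (1 / a) * φ x ≤ (1 / a) * (φ x * η x ^ 2) / F x ^ 2 := by
        rw [le_div_iff₀ (by positivity), ← mul_assoc]
        exact mul_le_mul_of_nonneg_left hsq hc
      rw [neg_div, neg_neg]
      linarith
  have hle := hmono (Set.left_mem_Icc.2 hr.le) (Set.right_mem_Icc.2 hr.le) hr.le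
  have hF₀ : (F r₀)⁻¹ = a / A := by simp [hF]
  have hF₁ : 0 < (F r₁)⁻¹ := inv_pos.2 (hFpos r₁ (Set.right_mem_Icc.2 hr.le))
  simp only [hF₀, intervalIntegral.integral_same, mul_zero, sub_zero] at hle
  have hlt : (1 / a) * ∫ s in r₀..r₁, φ s < a / A := by linarith
  calc (∫ s in r₀..r₁, φ s) = a * ((1 / a) * ∫ s in r₀..r₁, φ s) := by field_simp
    _ < a * (a / A) := mul_lt_mul_of_pos_left hlt ha
    _ = a ^ 2 / A := by ring
    _ < 2 * a ^ 2 / A := by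
      gcongr
      nlinarith [pow_pos ha 2]
end

section
/- For every real c ≥ 1 and every r ≥ 1, ∫_{1}^{r} ds/√(c s⁶ − s²) = (1/2)·arctan(√(c r⁴ − 1)) − (1/2)·arctan(√(c − 1)). Consequently the improper integral ∫_{1}^{∞} ds/√(c s⁶ − s²) converges and equals π/4 − (1/2)·arctan(√(c − 1)), which lies in (0, π/4]. -/
open MeasureTheory Filter Topology

lemma one_lt_mul_pow_four {c s : ℝ} (hc : 1 ≤ c) (hs : 1 < s) : 1 < c * s ^ 4 :=
  one_lt_mul_of_le_of_lt hc (one_lt_pow₀ hs four_ne_zero)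

lemma sqrt_mul_pow_six_sub_sq (c : ℝ) {s : ℝ} (hs : 0 ≤ s) :
    √(c * s ^ 6 - s ^ 2) = s * √(c * s ^ 4 - 1) := by
  rw [show c * s ^ 6 - s ^ 2 = s ^ 2 * (c * s ^ 4 - 1) by ring,
    Real.sqrt_mul (sq_nonneg s), Real.sqrt_sq hs]

lemma hasDerivAt_half_arctan_sqrt {c s : ℝ} (hs : 0 < s) (h : 1 < c * s ^ 4) :
    HasDerivAt (fun s : ℝ => 1 / 2 * Real.arctan √(c * s ^ 4 - 1))
      (1 / √(c * s ^ 6 - s ^ 2)) s := by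
  have hpos : 0 < c * s ^ 4 - 1 := sub_pos.2 h
  have hw : 0 < √(c * s ^ 4 - 1) := Real.sqrt_pos.2 hpos
  have hc : c ≠ 0 := by
    rintro rfl
    norm_num at h
  have hd : HasDerivAt (fun s : ℝ => c * s ^ 4 - 1) (c * (4 * s ^ 3)) s := by
    simpa using ((hasDerivAt_pow 4 s).const_mul c).sub_const 1
  refine ((hd.sqrt hpos.ne').arctan.const_mul (1 / 2)).congr_deriv ?_
  rw [sqrt_mul_pow_six_sub_sq c hs.le, Real.sq_sqrt hpos.le, add_sub_cancel]
  field_simp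
  norm_num

lemma continuous_half_arctan_sqrt (c : ℝ) :
    Continuous (fun s : ℝ => 1 / 2 * Real.arctan √(c * s ^ 4 - 1)) := by
  have := Real.continuous_arctan
  fun_prop

lemma tendsto_half_arctan_sqrt {c : ℝ} (hc : 0 < c) :
    Tendsto (fun s : ℝ => 1 / 2 * Real.arctan √(c * s ^ 4 - 1)) atTop (𝓝 (Real.pi / 4)) := by
  have h : Tendsto (fun s : ℝ => √(c * s ^ 4 - 1)) atTop atTop :=
    Real.tendsto_sqrt_atTop.comp <| tendsto_atTop_add_const_right _ (-1) <|
      (tendsto_pow_atTop four_ne_zero).const_mul_atTop hc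
  have h' := ((tendsto_nhds_of_tendsto_nhdsWithin Real.tendsto_arctan_atTop).comp h).const_mul
    (1 / 2)
  rwa [show 1 / 2 * (Real.pi / 2) = Real.pi / 4 by ring] at h'

/-- Explicit evaluation of the rotational minimal graph integrals in the warped
product `ℝ² ×_μ ℝ` with `μ(r) = r` (Example 4.4): for `c ≥ 1`,
`∫₁^r ds/√(cs⁶ − s²) = ½ arctan √(cr⁴ − 1) − ½ arctan √(c − 1)`, and the improper
integral over `(1, ∞)` converges to `π/4 − ½ arctan √(c − 1) ∈ (0, π/4]`. -/
theorem rotational_minimal_graph_integral (c : ℝ) (hc : 1 ≤ c) :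
    (∀ r ≥ (1 : ℝ),
      (∫ s in (1 : ℝ)..r, 1 / Real.sqrt (c * s ^ 6 - s ^ 2)) =
        (1 / 2) * Real.arctan (Real.sqrt (c * r ^ 4 - 1)) -
          (1 / 2) * Real.arctan (Real.sqrt (c - 1))) ∧
    IntegrableOn (fun s => 1 / Real.sqrt (c * s ^ 6 - s ^ 2)) (Set.Ioi 1) ∧
    (∫ s in Set.Ioi (1 : ℝ), 1 / Real.sqrt (c * s ^ 6 - s ^ 2)) =
      Real.pi / 4 - (1 / 2) * Real.arctan (Real.sqrt (c - 1)) ∧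
    Real.pi / 4 - (1 / 2) * Real.arctan (Real.sqrt (c - 1)) ∈
      Set.Ioc 0 (Real.pi / 4) := by
  have hderiv : ∀ s ∈ Set.Ioi (1 : ℝ),
      HasDerivAt (fun s : ℝ => 1 / 2 * Real.arctan √(c * s ^ 4 - 1))
        (1 / √(c * s ^ 6 - s ^ 2)) s := fun s hs =>
    hasDerivAt_half_arctan_sqrt (zero_lt_one.trans hs) (one_lt_mul_pow_four hc hs)
  have hcont := continuous_half_arctan_sqrt c
  have hlim := tendsto_half_arctan_sqrt (zero_lt_one.trans_le hc)
  have hint : IntegrableOn (fun s => 1 / √(c * s ^ 6 - s ^ 2)) (Set.Ioi 1) :=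
    integrableOn_Ioi_deriv_of_nonneg hcont.continuousWithinAt hderiv
      (fun _ _ => by positivity) hlim
  refine ⟨fun r hr => ?_, hint, ?_, ?_, ?_⟩
  · rw [intervalIntegral.integral_eq_sub_of_hasDerivAt_of_le hr hcont.continuousOn
      (fun s hs => hderiv s hs.1)
      ((intervalIntegrable_iff_integrableOn_Ioc_of_le hr).2
        (hint.mono_set Set.Ioc_subset_Ioi_self))]
    simp
  · rw [integral_Ioi_of_hasDerivAt_of_tendsto hcont.continuousWithinAt hderiv hint hlim]
    simp
  · linarith [Real.arctan_lt_pi_div_two √(c - 1)]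
  · linarith [Real.arctan_nonneg.2 (Real.sqrt_nonneg (c - 1))]
end

section
/- Let Ω = {(x, y) ∈ ℝ² : y > 1} and u(x, y) = 1 − 1/y. Then u satisfies the Sol₃ minimal graph equation div( y² ∇u / √(1 + y⁴ ‖∇u‖²) ) = 0 on Ω, 0 < u < 1 on Ω, and u extends continuously to {y = 1} with value 0 there. In particular, Sol₃ admits a nonzero bounded positive minimal Killing graph over an unbounded domain with zero boundary values. -/
noncomputable section

/-- The Euclidean divergence of a vector field on `ℝ²`. -/
def vdiv (F : EuclideanSpace ℝ (Fin 2) → EuclideanSpace ℝ (Fin 2))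
    (x : EuclideanSpace ℝ (Fin 2)) : ℝ :=
  ∑ i, fderiv ℝ F x (EuclideanSpace.single i 1) i

/-- Above the horizontal axis the gradient of `1 - 1 / y` is `(0, 1 / y ^ 2)`. -/
theorem gradient_one_sub_inv_snd {x : EuclideanSpace ℝ (Fin 2)} (hx : 0 < x 1) :
    gradient (fun w : EuclideanSpace ℝ (Fin 2) => 1 - 1 / w 1) x =
      (1 / (x 1) ^ 2) • EuclideanSpace.single 1 1 := by
  apply HasGradientAt.gradient
  rw [hasGradientAt_iff_hasFDerivAt]
  have hproj : HasFDerivAt (fun w : EuclideanSpace ℝ (Fin 2) => w 1)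
      (EuclideanSpace.proj 1 : EuclideanSpace ℝ (Fin 2) →L[ℝ] ℝ) x :=
    (EuclideanSpace.proj 1 : EuclideanSpace ℝ (Fin 2) →L[ℝ] ℝ).hasFDerivAt
  have hderiv : HasDerivAt (fun t : ℝ => 1 - 1 / t) (1 / (x 1) ^ 2) (x 1) := by
    simpa using (hasDerivAt_inv hx.ne').const_sub 1
  refine (hderiv.comp_hasFDerivAt x hproj).congr_fderiv ?_
  refine ContinuousLinearMap.ext fun v => ?_
  simp [EuclideanSpace.inner_single_left]

/-- Above the horizontal axis the normalised weighted gradient of `1 - 1 / y` is constant. -/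
theorem weighted_gradient_one_sub_inv_snd {x : EuclideanSpace ℝ (Fin 2)} (hx : 0 < x 1) :
    ((x 1) ^ 2 / Real.sqrt (1 + (x 1) ^ 4 *
        ‖gradient (fun w : EuclideanSpace ℝ (Fin 2) => 1 - 1 / w 1) x‖ ^ 2)) •
      gradient (fun w : EuclideanSpace ℝ (Fin 2) => 1 - 1 / w 1) x =
      (1 / Real.sqrt 2) • EuclideanSpace.single 1 1 := by
  have hnorm : (x 1) ^ 4 *
      ‖(1 / (x 1) ^ 2) • (EuclideanSpace.single 1 1 : EuclideanSpace ℝ (Fin 2))‖ ^ 2 = 1 := by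
    rw [norm_smul, PiLp.norm_single, norm_one, mul_one, Real.norm_eq_abs, sq_abs]
    field_simp
  rw [gradient_one_sub_inv_snd hx, hnorm, one_add_one_eq_two, smul_smul]
  congr 1
  field_simp

/-- In `Sol₃`, viewed as a Killing submersion over the hyperbolic half-plane with
Killing length `μ(x,y) = y`, the function `u(x,y) = 1 − 1/y` is a bounded positive
minimal Killing graph over `{y > 1}` with zero boundary values: it satisfies
`div(y²∇u/√(1 + y⁴‖∇u‖²)) = 0`, `0 < u < 1`, and extends continuously by `0` to
`{y = 1}` (Example 4.5). -/
theorem sol3_bounded_minimal_graph :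
    (∀ q : EuclideanSpace ℝ (Fin 2), 1 < q 1 →
      vdiv (fun x =>
        ((x 1) ^ 2 / Real.sqrt (1 + (x 1) ^ 4 *
            ‖gradient (fun w : EuclideanSpace ℝ (Fin 2) => 1 - 1 / w 1) x‖ ^ 2)) •
          gradient (fun w : EuclideanSpace ℝ (Fin 2) => 1 - 1 / w 1) x) q = 0) ∧
    (∀ q : EuclideanSpace ℝ (Fin 2), 1 < q 1 →
      0 < 1 - 1 / q 1 ∧ 1 - 1 / q 1 < 1) ∧
    ContinuousOn (fun q : EuclideanSpace ℝ (Fin 2) => 1 - 1 / q 1)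
      {q | 1 ≤ q 1} ∧
    (∀ q : EuclideanSpace ℝ (Fin 2), q 1 = 1 → 1 - 1 / q 1 = 0) := by
  refine ⟨fun q hq => ?_, fun q hq => ?_, ?_, fun q hq => by simp [hq]⟩
  · have hpos : ∀ᶠ x : EuclideanSpace ℝ (Fin 2) in nhds q, 0 < x 1 :=
      continuousAt_const.eventually_lt (f := fun _ => (0 : ℝ))
        (g := fun x : EuclideanSpace ℝ (Fin 2) => x 1) (by fun_prop) (by linarith)
    have hconst := hpos.mono fun x hx => weighted_gradient_one_sub_inv_snd hx
    rw [vdiv, Filter.EventuallyEq.fderiv_eq hconst]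
    simp
  · have hq0 : 0 < q 1 := one_pos.trans hq
    have hlt : 1 / q 1 < 1 := (div_lt_one hq0).2 hq
    have hinv : 0 < 1 / q 1 := one_div_pos.2 hq0
    constructor <;> linarith
  · refine continuousOn_const.sub (continuousOn_const.div (by fun_prop) fun q hq => ?_)
    exact (one_pos.trans_le hq).ne'

end
end

section
/- Let τ ∈ ℝ, let a < b be real numbers, let Ω ⊆ ℝ × (a, b) be an open domain, and let u ∈ C²(Ω) ∩ C⁰(Ω̄) satisfy the Nil₃(τ) minimal graph equation on Ω with u(x, y) = τ·x·y for every (x, y) ∈ ∂Ω. Then u(x, y) = τ·x·y for every (x, y) ∈ Ω. (Here (x, y) ↦ τ·x·y itself satisfies the Nil₃(τ) minimal graph equation on all of ℝ².) -/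
noncomputable section

/-- `α = ∂ₓu + τy` in the Heisenberg group model `Nil₃(τ)`. -/
def nilAlpha (τ : ℝ) (u : ℝ × ℝ → ℝ) (p : ℝ × ℝ) : ℝ :=
  fderiv ℝ u p (1, 0) + τ * p.2

/-- `β = ∂_yu − τx` in the Heisenberg group model `Nil₃(τ)`. -/
def nilBeta (τ : ℝ) (u : ℝ × ℝ → ℝ) (p : ℝ × ℝ) : ℝ :=
  fderiv ℝ u p (0, 1) - τ * p.1

/-- The area element `W = √(1 + α² + β²)`. -/
def nilW (τ : ℝ) (u : ℝ × ℝ → ℝ) (p : ℝ × ℝ) : ℝ :=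
  Real.sqrt (1 + nilAlpha τ u p ^ 2 + nilBeta τ u p ^ 2)

/-- The `Nil₃(τ)` minimal graph equation `∂ₓ(α/W) + ∂_y(β/W) = 0` on `Ω`. -/
def NilMinimal (τ : ℝ) (u : ℝ × ℝ → ℝ) (Ω : Set (ℝ × ℝ)) : Prop :=
  ∀ p ∈ Ω,
    fderiv ℝ (fun q => nilAlpha τ u q / nilW τ u q) p (1, 0) +
      fderiv ℝ (fun q => nilBeta τ u q / nilW τ u q) p (0, 1) = 0

open Filter Topology Set

theorem fderiv_normalized_divergence {α β : ℝ × ℝ → ℝ} {A B : ℝ × ℝ →L[ℝ] ℝ} {p : ℝ × ℝ}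
    (hα : HasFDerivAt α A p) (hβ : HasFDerivAt β B p) :
    (fderiv ℝ (fun q => α q / √(1 + α q ^ 2 + β q ^ 2)) p (1, 0) +
      fderiv ℝ (fun q => β q / √(1 + α q ^ 2 + β q ^ 2)) p (0, 1)) *
        √(1 + α p ^ 2 + β p ^ 2) ^ 3 =
      (1 + β p ^ 2) * A (1, 0) - α p * β p * (A (0, 1) + B (1, 0)) +
        (1 + α p ^ 2) * B (0, 1) := by
  have hpos : 0 < 1 + α p ^ 2 + β p ^ 2 := by positivity
  have hW := (((hα.pow 2).const_add 1).add (hβ.pow 2)).sqrt hpos.ne'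
  have hs : 0 < √(1 + α p ^ 2 + β p ^ 2) := Real.sqrt_pos.2 hpos
  have hsq := Real.sq_sqrt hpos.le
  have hI := (hasDerivAt_inv hs.ne').comp_hasFDerivAt p hW
  have h1 : fderiv ℝ (fun q => α q / √(1 + α q ^ 2 + β q ^ 2)) p = _ := (hα.mul hI).fderiv
  have h2 : fderiv ℝ (fun q => β q / √(1 + α q ^ 2 + β q ^ 2)) p = _ := (hβ.mul hI).fderiv
  rw [h1, h2]
  simp only [Pi.add_apply, Function.comp_apply]
  simp only [smul_apply, add_apply, smul_eq_mul]
  generalize √(1 + α p ^ 2 + β p ^ 2) = s at *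
  field_simp
  norm_num
  rw [hsq]
  ring

theorem HasFDerivAt.fderiv_flip {u : ℝ × ℝ → ℝ} {p : ℝ × ℝ} {B : ℝ × ℝ →L[ℝ] ℝ × ℝ →L[ℝ] ℝ}
    (hB : HasFDerivAt (fderiv ℝ u) B p) (d : ℝ × ℝ) :
    HasFDerivAt (fun q => fderiv ℝ u q d) (B.flip d) p :=
  (hB.clm_apply (hasFDerivAt_const d p)).congr_fderiv (by ext <;> simp)

theorem NilMinimal.expanded {τ : ℝ} {u : ℝ × ℝ → ℝ} {Ω : Set (ℝ × ℝ)} (h : NilMinimal τ u Ω)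
    {p : ℝ × ℝ} (hp : p ∈ Ω) {B : ℝ × ℝ →L[ℝ] ℝ × ℝ →L[ℝ] ℝ} (hB : HasFDerivAt (fderiv ℝ u) B p) :
    B (1, 0) (1, 0) + B (0, 1) (0, 1) +
      B (nilBeta τ u p, -nilAlpha τ u p) (nilBeta τ u p, -nilAlpha τ u p) = 0 := by
  have hα : HasFDerivAt (nilAlpha τ u)
      (B.flip (1, 0) + τ • ContinuousLinearMap.snd ℝ ℝ ℝ) p :=
    (hB.fderiv_flip (1, 0)).add (hasFDerivAt_snd.const_mul τ)
  have hβ : HasFDerivAt (nilBeta τ u)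
      (B.flip (0, 1) - τ • ContinuousLinearMap.fst ℝ ℝ ℝ) p :=
    (hB.fderiv_flip (0, 1)).sub (hasFDerivAt_fst.const_mul τ)
  have key := fderiv_normalized_divergence hα hβ
  have h0 := h p hp
  simp only [nilW] at h0
  rw [h0] at key
  have hvec : ∀ r s : ℝ, ((r, -s) : ℝ × ℝ) = r • (1, 0) + (-s) • (0, 1) := by
    intro r s; simp
  rw [hvec]
  simp only [map_add, map_smul, add_apply, smul_apply, smul_eq_mul]
  simp at key
  linarith

theorem nonpos_of_isLocalMax_of_hasDerivAt {φ φ' : ℝ → ℝ} {t c : ℝ} (hmax : IsLocalMax φ t)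
    (h1 : ∀ᶠ s in 𝓝 t, HasDerivAt φ (φ' s) s) (h2 : HasDerivAt φ' c t) : c ≤ 0 := by
  by_contra! hc
  have hd : deriv φ =ᶠ[𝓝 t] φ' := h1.mono fun s hs => hs.deriv
  have h2' : deriv (deriv φ) t = c := hd.deriv_eq.trans h2.deriv
  have hmin : IsLocalMin φ t := isLocalMin_of_deriv_deriv_pos (h2' ▸ hc)
    hmax.deriv_eq_zero h1.self_of_nhds.continuousAt
  have hconst : φ =ᶠ[𝓝 t] fun _ => φ t := by
    filter_upwards [hmax, hmin] with s hs hs' using le_antisymm hs hs'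
  have := hconst.deriv.deriv_eq
  simp [h2'] at this
  exact hc.ne' this

/-- First and second order conditions at a local maximum of `u - (τxy + f(x) + g(y))`. -/
theorem NilMinimal.nonneg_of_isLocalMax {τ : ℝ} {u : ℝ × ℝ → ℝ} {Ω : Set (ℝ × ℝ)}
    (hmin : NilMinimal τ u Ω) (hΩ : IsOpen Ω) (hu : ContDiffOn ℝ 2 u Ω) {p : ℝ × ℝ} (hp : p ∈ Ω)
    {f f' g g' : ℝ → ℝ} {f'' g'' : ℝ}
    (hf : ∀ᶠ x in 𝓝 p.1, HasDerivAt f (f' x) x) (hf' : HasDerivAt f' f'' p.1)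
    (hg : ∀ᶠ y in 𝓝 p.2, HasDerivAt g (g' y) y) (hg' : HasDerivAt g' g'' p.2)
    (hmax : IsLocalMax (fun q : ℝ × ℝ => u q - (τ * q.1 * q.2 + f q.1 + g q.2)) p) :
    0 ≤ (1 + g' p.2 ^ 2) * f'' + (1 + (2 * τ * p.2 + f' p.1) ^ 2) * g'' -
      2 * τ * (2 * τ * p.2 + f' p.1) * g' p.2 := by
  have hup : ContDiffAt ℝ 2 u p := hu.contDiffAt (hΩ.mem_nhds hp)
  have hB : HasFDerivAt (fderiv ℝ u) (fderiv ℝ (fderiv ℝ u) p) p :=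
    ((hup.fderiv_right (m := 1) (by norm_num)).differentiableAt (by norm_num)).hasFDerivAt
  generalize fderiv ℝ (fderiv ℝ u) p = B at hB
  have hu1 : ∀ᶠ q in 𝓝 p, HasFDerivAt u (fderiv ℝ u q) q := by
    filter_upwards [hΩ.mem_nhds hp] with q hq
    exact ((hu.contDiffAt (hΩ.mem_nhds hq)).differentiableAt (by norm_num)).hasFDerivAt
  have line : ∀ d : ℝ × ℝ, ∀ t, HasDerivAt (fun t : ℝ => p + t • d) d t := fun d t => by
    simpa using ((hasDerivAt_id t).smul_const d).const_add p
  have dir : ∀ d : ℝ × ℝ,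
      fderiv ℝ u p d = τ * (d.1 * p.2 + p.1 * d.2) + f' p.1 * d.1 + g' p.2 * d.2 ∧
      B d d ≤ 2 * τ * d.1 * d.2 + f'' * d.1 ^ 2 + g'' * d.2 ^ 2 := by
    intro d
    have hl0 : p + (0 : ℝ) • d = p := by simp
    have hlt : Tendsto (fun t : ℝ => p + t • d) (𝓝 0) (𝓝 p) := by
      simpa using (line d 0).continuousAt.tendsto
    have l1 : ∀ t, HasDerivAt (fun t : ℝ => p.1 + t * d.1) d.1 t := fun t => by
      simpa using ((hasDerivAt_id t).mul_const d.1).const_add p.1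
    have l2 : ∀ t, HasDerivAt (fun t : ℝ => p.2 + t * d.2) d.2 t := fun t => by
      simpa using ((hasDerivAt_id t).mul_const d.2).const_add p.2
    have ht1 : Tendsto (fun t : ℝ => p.1 + t * d.1) (𝓝 0) (𝓝 p.1) := by
      simpa using (l1 0).continuousAt.tendsto
    have ht2 : Tendsto (fun t : ℝ => p.2 + t * d.2) (𝓝 0) (𝓝 p.2) := by
      simpa using (l2 0).continuousAt.tendsto
    have m : IsLocalMax (fun t : ℝ => u (p + t • d) - (τ * (p.1 + t * d.1) * (p.2 + t * d.2)
        + f (p.1 + t * d.1) + g (p.2 + t * d.2))) 0 := by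
      have := hlt.eventually hmax
      simpa [IsLocalMax, IsMaxFilter] using this
    have e1 : ∀ᶠ t in 𝓝 (0 : ℝ), HasDerivAt (fun t : ℝ => u (p + t • d) -
        (τ * (p.1 + t * d.1) * (p.2 + t * d.2) + f (p.1 + t * d.1) + g (p.2 + t * d.2)))
        (fderiv ℝ u (p + t • d) d - (τ * d.1 * (p.2 + t * d.2) + τ * (p.1 + t * d.1) * d.2
          + f' (p.1 + t * d.1) * d.1 + g' (p.2 + t * d.2) * d.2)) t := by
      filter_upwards [hlt.eventually hu1, ht1.eventually hf, ht2.eventually hg] with t hut hft hgt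
      exact (hut.comp_hasDerivAt t (line d t)).sub
        (((((l1 t).const_mul τ).mul (l2 t)).add (hft.comp t (l1 t))).add (hgt.comp t (l2 t)))
    have e2 : HasDerivAt (fun t : ℝ => fderiv ℝ u (p + t • d) d -
        (τ * d.1 * (p.2 + t * d.2) + τ * (p.1 + t * d.1) * d.2
          + f' (p.1 + t * d.1) * d.1 + g' (p.2 + t * d.2) * d.2))
        (B d d - (τ * d.1 * d.2 + τ * d.1 * d.2 + f'' * d.1 * d.1 + g'' * d.2 * d.2)) 0 := by
      have hB0 : HasFDerivAt (fderiv ℝ u) B (p + (0 : ℝ) • d) := by rwa [hl0]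
      have hf0 : HasDerivAt f' f'' (p.1 + 0 * d.1) := by simpa using hf'
      have hg0 : HasDerivAt g' g'' (p.2 + 0 * d.2) := by simpa using hg'
      have a1 : HasDerivAt (fun t : ℝ => fderiv ℝ u (p + t • d) d) (B d d) 0 := by
        exact (hB0.fderiv_flip d).comp_hasDerivAt 0 (line d 0)
      exact a1.sub (((((l2 0).const_mul (τ * d.1)).add
        (((l1 0).const_mul τ).mul_const d.2)).add ((hf0.comp 0 (l1 0)).mul_const d.1)).add
        ((hg0.comp 0 (l2 0)).mul_const d.2))
    have c1 := m.hasDerivAt_eq_zero e1.self_of_nhds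
    have c2 := nonpos_of_isLocalMax_of_hasDerivAt m e1 e2
    simp only [hl0, zero_mul, add_zero] at c1
    constructor <;> linarith
  have hα : nilAlpha τ u p = 2 * τ * p.2 + f' p.1 := by
    rw [nilAlpha, (dir (1, 0)).1]; ring
  have hβ : nilBeta τ u p = g' p.2 := by
    rw [nilBeta, (dir (0, 1)).1]; ring
  have h0 := hmin.expanded hp hB
  rw [hα, hβ] at h0
  have d1 := (dir (1, 0)).2
  have d2 := (dir (0, 1)).2
  have d3 := (dir (g' p.2, -(2 * τ * p.2 + f' p.1))).2
  simp only at d1 d2 d3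
  linarith

theorem barrier_inequality {τ y T m l G : ℝ} (hy : y ^ 2 ≤ m ^ 2) (hl : 0 < l) (hG0 : 0 < G)
    (hG1 : G ≤ 1) (hG : 2 * l * (2 + 8 * τ ^ 2 * m ^ 2) < G) :
    (1 + G ^ 2) * (l * (1 + T ^ 2)) <
      (1 + (2 * τ * y + T) ^ 2) * ((|τ| + 1) * G) + 2 * τ * (2 * τ * y + T) * G := by
  set S := 2 * τ * y + T with hS
  set C := 2 + 8 * τ ^ 2 * m ^ 2 with hC
  have hT : 1 + T ^ 2 ≤ C * (1 + S ^ 2) := by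
    have h1 : 8 * τ ^ 2 * y ^ 2 ≤ 8 * τ ^ 2 * m ^ 2 := by gcongr
    have h2 : T ^ 2 ≤ 2 * S ^ 2 + 8 * τ ^ 2 * y ^ 2 := by
      rw [hS]; linarith [sq_nonneg (T + 4 * τ * y)]
    have h3 : 0 ≤ 8 * τ ^ 2 * m ^ 2 * S ^ 2 := by positivity
    rw [hC]; linarith
  have hτS : -(2 * τ * S) ≤ |τ| * (1 + S ^ 2) := by
    have h1 : -(2 * τ * S) ≤ 2 * (|τ| * |S|) := by
      rw [← abs_mul]; linarith [neg_abs_le (τ * S)]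
    have h2 := mul_nonneg (abs_nonneg τ) (sq_nonneg (|S| - 1))
    rw [← sq_abs S]
    linarith
  have i1 : -(2 * τ * S) * G ≤ |τ| * (1 + S ^ 2) * G := by gcongr
  have hG2 : 1 + G ^ 2 ≤ 2 := by nlinarith
  have i2 : (1 + G ^ 2) * (l * (1 + T ^ 2)) ≤ 2 * (l * (C * (1 + S ^ 2))) := by gcongr
  have i3 : 2 * l * C * (1 + S ^ 2) < G * (1 + S ^ 2) := by gcongr
  linarith

/-- Comparison with the barrier `τxy - log (cos (lx)) / l + ε (1 - exp (-κ(y - a))) / κ`. -/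
theorem NilMinimal.le_barrier {τ a b : ℝ} {Ω : Set (ℝ × ℝ)} (hΩo : IsOpen Ω)
    (hΩs : Ω ⊆ {p : ℝ × ℝ | p.2 ∈ Ioo a b})
    {u : ℝ × ℝ → ℝ} (hu : ContDiffOn ℝ 2 u Ω) (hu0 : ContinuousOn u (closure Ω))
    (hmin : NilMinimal τ u Ω) (hbd : ∀ p ∈ frontier Ω, u p = τ * p.1 * p.2)
    {ε l : ℝ} (hε : 0 < ε) (hε1 : ε ≤ 1) (hl : 0 < l)
    (hlε : 2 * l * (2 + 8 * τ ^ 2 * (|a| + |b|) ^ 2) < ε * Real.exp (-((|τ| + 1) * (b - a))))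
    {p₀ : ℝ × ℝ} (hp₀ : p₀ ∈ Ω) (hlp : l * |p₀.1| < Real.pi / 2) :
    u p₀ ≤ τ * p₀.1 * p₀.2 + -(l⁻¹ * Real.log (Real.cos (l * p₀.1))) +
      ε / (|τ| + 1) * (1 - Real.exp (-((|τ| + 1) * (p₀.2 - a)))) := by
  set κ := |τ| + 1 with hκ
  have hκ0 : 0 < κ := by positivity
  set f : ℝ → ℝ := fun x => -(l⁻¹ * Real.log (Real.cos (l * x))) with hfdef
  set g : ℝ → ℝ := fun y => ε / κ * (1 - Real.exp (-(κ * (y - a))))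
  change u p₀ ≤ τ * p₀.1 * p₀.2 + f p₀.1 + g p₀.2
  by_contra! hlt
  set R := Real.pi / 2 / l with hR
  have hcl : closure Ω ⊆ {p : ℝ × ℝ | p.2 ∈ Icc a b} :=
    closure_minimal (hΩs.trans fun p hp => Ioo_subset_Icc_self hp)
      (isClosed_Icc.preimage continuous_snd)
  have hcos0 : 0 < Real.cos (l * p₀.1) := by
    have := abs_lt.1 (show |l * p₀.1| < Real.pi / 2 by rwa [abs_mul, abs_of_pos hl])
    exact Real.cos_pos_of_mem_Ioo ⟨this.1, this.2⟩
  have hcpt : IsCompact (closure Ω ∩ {p : ℝ × ℝ | p.1 ∈ Icc (-R) R}) := by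
    refine IsCompact.of_isClosed_subset (isCompact_Icc (a := -R) (b := R) |>.prod
      (isCompact_Icc (a := a) (b := b)))
      (isClosed_closure.inter (isClosed_Icc.preimage continuous_fst)) ?_
    exact fun p hp => ⟨hp.2, hcl hp.1⟩
  obtain ⟨M, hM⟩ := hcpt.exists_bound_of_continuousOn
    (f := fun p : ℝ × ℝ => u p - τ * p.1 * p.2)
    ((hu0.mono inter_subset_left).sub (by fun_prop))
  set c := min (Real.exp (-(l * M))) (Real.cos (l * p₀.1))
  have hc0 : 0 < c := lt_min (Real.exp_pos _) hcos0
  set K := (closure Ω ∩ {p : ℝ × ℝ | p.1 ∈ Icc (-R) R}) ∩ {p : ℝ × ℝ | c ≤ Real.cos (l * p.1)}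
  have hKc : IsCompact K := hcpt.inter_right (isClosed_le (by fun_prop) (by fun_prop))
  have hp₀K : p₀ ∈ K := by
    refine ⟨⟨subset_closure hp₀, ?_⟩, min_le_right (Real.exp (-(l * M))) _⟩
    have : |p₀.1| ≤ R := by rw [hR, le_div_iff₀ hl]; linarith
    exact abs_le.1 this
  have hcont : ContinuousOn (fun q : ℝ × ℝ => u q - (τ * q.1 * q.2 + f q.1 + g q.2)) K := by
    refine (hu0.mono fun q hq => hq.1.1).sub (ContinuousOn.add (ContinuousOn.add (by fun_prop) ?_)
      (by fun_prop))
    refine (ContinuousOn.mul (by fun_prop) (ContinuousOn.log (by fun_prop) ?_)).neg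
    exact fun q hq => (hc0.trans_le hq.2).ne'
  obtain ⟨p, hpK, hpmax⟩ := hKc.exists_isMaxOn ⟨p₀, hp₀K⟩ hcont
  have hpos : τ * p.1 * p.2 + f p.1 + g p.2 < u p := by
    have := hpmax hp₀K
    simp only [mem_ofPred_eq] at this
    linarith
  have hy := hcl hpK.1.1
  have hcp : 0 < Real.cos (l * p.1) := hc0.trans_le hpK.2
  have hf0 : 0 ≤ f p.1 := by
    have := Real.log_nonpos hcp.le (Real.cos_le_one _)
    simp only [hfdef]
    have := mul_nonpos_of_nonneg_of_nonpos (inv_pos.2 hl).le this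
    linarith
  have hg0 : 0 ≤ g p.2 := by
    have : Real.exp (-(κ * (p.2 - a))) ≤ 1 := Real.exp_le_one_iff.2
      (neg_nonpos.2 (mul_nonneg hκ0.le (sub_nonneg.2 hy.1)))
    exact mul_nonneg (by positivity) (by linarith)
  have hpΩ : p ∈ Ω := by
    by_contra hn
    have := hbd p ⟨hpK.1.1, fun h => hn (interior_subset h)⟩
    linarith
  have hclt : c < Real.cos (l * p.1) := by
    refine lt_of_le_of_ne hpK.2 fun heq => ?_
    have h1 : Real.log c ≤ -(l * M) := (Real.log_le_iff_le_exp hc0).2 (min_le_left _ _)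
    have h2 : M ≤ f p.1 := by
      simp only [hfdef, ← heq]
      rw [← mul_neg, le_inv_mul_iff₀ hl]
      linarith
    have h3 := (le_abs_self _).trans (hM p hpK.1)
    linarith
  have hpR : p.1 ∈ Ioo (-R) R := by
    have hlR : l * R = Real.pi / 2 := by rw [hR]; field_simp
    refine ⟨lt_of_le_of_ne hpK.1.2.1 fun h => ?_, lt_of_le_of_ne hpK.1.2.2 fun h => ?_⟩
    · rw [← h, mul_neg, hlR, Real.cos_neg, Real.cos_pi_div_two] at hcp
      exact lt_irrefl _ hcp
    · rw [h, hlR, Real.cos_pi_div_two] at hcp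
      exact lt_irrefl _ hcp
  have hKn : K ∈ 𝓝 p := by
    have n1 : ∀ᶠ q : ℝ × ℝ in 𝓝 p, q.1 ∈ Ioo (-R) R :=
      continuous_fst.continuousAt.eventually (isOpen_Ioo.mem_nhds hpR)
    have n2 : ∀ᶠ q : ℝ × ℝ in 𝓝 p, c < Real.cos (l * q.1) :=
      Tendsto.eventually_const_lt hclt (Continuous.tendsto (by fun_prop) p)
    filter_upwards [hΩo.mem_nhds hpΩ, n1, n2] with q h1 h2 h3
    exact ⟨⟨subset_closure h1, Ioo_subset_Icc_self h2⟩, h3.le⟩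
  have hlin : ∀ x : ℝ, HasDerivAt (fun x => l * x) l x := fun x => by
    simpa using (hasDerivAt_id x).const_mul l
  have hf1 : ∀ᶠ x in 𝓝 p.1, HasDerivAt f (Real.tan (l * x)) x := by
    have n2 : ∀ᶠ x in 𝓝 p.1, c < Real.cos (l * x) :=
      Tendsto.eventually_const_lt hclt (Continuous.tendsto (by fun_prop) p.1)
    filter_upwards [n2] with x hx
    have hx0 : Real.cos (l * x) ≠ 0 := (hc0.trans hx).ne'
    refine ((((hlin x).cos.log hx0).const_mul l⁻¹).neg).congr_deriv ?_
    rw [Real.tan_eq_sin_div_cos]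
    field_simp
  have hf2 : HasDerivAt (fun x => Real.tan (l * x)) (l * (1 + Real.tan (l * p.1) ^ 2)) p.1 := by
    refine ((Real.hasDerivAt_tan hcp.ne').comp p.1 (hlin p.1)).congr_deriv ?_
    rw [one_div, ← Real.inv_one_add_tan_sq hcp.ne', inv_inv]
    ring
  have hexp : ∀ y, HasDerivAt (fun y => Real.exp (-(κ * (y - a))))
      (Real.exp (-(κ * (y - a))) * (-κ)) y := fun y => by
    simpa using ((((hasDerivAt_id y).sub_const a).const_mul κ).neg).exp
  have hg1 : ∀ y, HasDerivAt g (ε * Real.exp (-(κ * (y - a)))) y := fun y => by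
    refine (((hexp y).const_sub 1).const_mul (ε / κ)).congr_deriv ?_
    field_simp
  have hg2 := (hexp p.2).const_mul ε
  have key := hmin.nonneg_of_isLocalMax hΩo hu hpΩ hf1 hf2 (Eventually.of_forall hg1) hg2
    (hpmax.isLocalMax hKn)
  have hG : Real.exp (-(κ * (b - a))) ≤ Real.exp (-(κ * (p.2 - a))) := by
    gcongr
    exact hy.2
  have hG1 : Real.exp (-(κ * (p.2 - a))) ≤ 1 := Real.exp_le_one_iff.2
      (neg_nonpos.2 (mul_nonneg hκ0.le (sub_nonneg.2 hy.1)))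
  have hEpos := Real.exp_pos (-(κ * (p.2 - a)))
  have hym : p.2 ^ 2 ≤ (|a| + |b|) ^ 2 := by
    refine sq_le_sq' ?_ ?_
    · linarith [neg_abs_le a, abs_nonneg b, hy.1]
    · linarith [le_abs_self b, abs_nonneg a, hy.2]
  have hEε : ε * Real.exp (-(κ * (b - a))) ≤ ε * Real.exp (-(κ * (p.2 - a))) := by gcongr
  have := barrier_inequality (T := Real.tan (l * p.1)) hym hl (by positivity)
    (mul_le_one₀ hε1 hEpos.le hG1) (hlε.trans_le hEε)
  rw [hκ] at key this
  linarith

theorem NilMinimal.le_of_frontier {τ a b : ℝ} {Ω : Set (ℝ × ℝ)} (hΩo : IsOpen Ω)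
    (hΩs : Ω ⊆ {p : ℝ × ℝ | p.2 ∈ Ioo a b})
    {u : ℝ × ℝ → ℝ} (hu : ContDiffOn ℝ 2 u Ω) (hu0 : ContinuousOn u (closure Ω))
    (hmin : NilMinimal τ u Ω) (hbd : ∀ p ∈ frontier Ω, u p = τ * p.1 * p.2)
    {p : ℝ × ℝ} (hp : p ∈ Ω) : u p ≤ τ * p.1 * p.2 := by
  refine le_of_forall_pos_le_add fun δ hδ => ?_
  set ε := min 1 (δ / 2)
  have hε : 0 < ε := by positivity
  set C := 2 + 8 * τ ^ 2 * (|a| + |b|) ^ 2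
  have hlim : Tendsto (fun l => l⁻¹ * Real.log (Real.cos (l * p.1))) (𝓝[>] 0) (𝓝 0) := by
    have h : HasDerivAt (fun l => Real.log (Real.cos (l * p.1))) 0 0 := by
      have h1 : HasDerivAt (fun l : ℝ => l * p.1) p.1 0 := by
        simpa using (hasDerivAt_id (0 : ℝ)).mul_const p.1
      simpa using h1.cos.log (by simp)
    have := hasDerivAt_iff_tendsto_slope_zero.1 h
    simpa using this.mono_left (nhdsWithin_mono (s := Ioi 0) 0 fun x hx => (mem_Ioi.1 hx).ne')
  have e1 : ∀ᶠ l in 𝓝[>] (0 : ℝ), -ε < l⁻¹ * Real.log (Real.cos (l * p.1)) :=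
    hlim.eventually_const_lt (neg_lt_zero.2 hε)
  have e2 : ∀ᶠ l in 𝓝[>] (0 : ℝ), 2 * l * C < ε * Real.exp (-((|τ| + 1) * (b - a))) := by
    refine nhdsWithin_le_nhds (Tendsto.eventually_lt_const ?_ (Continuous.tendsto (by fun_prop) 0))
    simp only [mul_zero, zero_mul]
    positivity
  have e3 : ∀ᶠ l in 𝓝[>] (0 : ℝ), l * |p.1| < Real.pi / 2 := by
    refine nhdsWithin_le_nhds (Tendsto.eventually_lt_const ?_ (Continuous.tendsto (by fun_prop) 0))
    simp only [zero_mul]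
    positivity
  obtain ⟨l, h1, h2, h3, h4⟩ := (e1.and (e2.and (e3.and self_mem_nhdsWithin))).exists
  have key := hmin.le_barrier hΩo hΩs hu hu0 hbd hε (min_le_left _ _) h4 h2 hp h3
  have h5 : ε / (|τ| + 1) * (1 - Real.exp (-((|τ| + 1) * (p.2 - a)))) ≤ ε * 1 := by
    gcongr
    · have : Real.exp (-((|τ| + 1) * (p.2 - a))) ≤ 1 := Real.exp_le_one_iff.2
        (neg_nonpos.2 (mul_nonneg (by positivity) (sub_nonneg.2 (hΩs hp).1.le)))
      linarith
    · exact div_le_self hε.le (by linarith [abs_nonneg τ])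
    · linarith [Real.exp_pos (-((|τ| + 1) * (p.2 - a)))]
  have h6 : ε ≤ δ / 2 := min_le_right _ _
  linarith

theorem nilAlpha_neg (τ : ℝ) (u : ℝ × ℝ → ℝ) (p : ℝ × ℝ) :
    nilAlpha (-τ) (-u) p = -nilAlpha τ u p := by
  simp [nilAlpha, fderiv_neg, add_comm]

theorem nilBeta_neg (τ : ℝ) (u : ℝ × ℝ → ℝ) (p : ℝ × ℝ) :
    nilBeta (-τ) (-u) p = -nilBeta τ u p := by
  simp [nilBeta, fderiv_neg, add_comm, sub_eq_add_neg]

theorem NilMinimal.neg {τ : ℝ} {u : ℝ × ℝ → ℝ} {Ω : Set (ℝ × ℝ)} (h : NilMinimal τ u Ω) :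
    NilMinimal (-τ) (-u) Ω := by
  intro p hp
  have := h p hp
  simp only [nilW, nilAlpha_neg, nilBeta_neg, neg_sq, neg_div, fderiv_fun_neg,
    neg_apply] at this ⊢
  linarith

theorem nilMinimal_invariant (τ : ℝ) :
    NilMinimal τ (fun p => τ * p.1 * p.2) Set.univ := by
  intro p _
  have hd : ∀ q : ℝ × ℝ, HasFDerivAt (fun p : ℝ × ℝ => τ * p.1 * p.2)
      ((τ * q.1) • ContinuousLinearMap.snd ℝ ℝ ℝ +
        q.2 • (τ • ContinuousLinearMap.fst ℝ ℝ ℝ)) q :=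
    fun q => (hasFDerivAt_fst.const_mul τ).mul hasFDerivAt_snd
  have hα : nilAlpha τ (fun p => τ * p.1 * p.2) = fun q => 2 * τ * q.2 := by
    ext q; rw [nilAlpha, (hd q).fderiv]; simp; ring
  have hβ : nilBeta τ (fun p => τ * p.1 * p.2) = fun _ => 0 := by
    ext q; rw [nilBeta, (hd q).fderiv]; simp
  have key := fderiv_normalized_divergence (p := p)
    ((hasFDerivAt_snd (𝕜 := ℝ) (E := ℝ) (F := ℝ)).const_mul (2 * τ)) (hasFDerivAt_const (0 : ℝ) p)
  simp only [nilW, hα, hβ]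
  have hs : √(1 + (2 * τ * p.2) ^ 2 + 0 ^ 2) ^ 3 ≠ 0 := by positivity
  refine (mul_eq_zero.1 (key.trans ?_)).resolve_right hs
  simp

/-- Lemma 5.1: the only solution of the Nil₃(τ) minimal graph equation over a domain
contained in a strip, with boundary values those of the invariant minimal surface
`u(x,y) = τxy`, is `τxy` itself (which indeed solves the equation on all of `ℝ²`). -/
theorem nil3_invariant_surface_uniqueness (τ a b : ℝ) (hab : a < b)
    (Ω : Set (ℝ × ℝ)) (hΩo : IsOpen Ω)
    (hΩs : Ω ⊆ {p : ℝ × ℝ | p.2 ∈ Set.Ioo a b})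
    (u : ℝ × ℝ → ℝ) (hu : ContDiffOn ℝ 2 u Ω)
    (hu0 : ContinuousOn u (closure Ω))
    (hmin : NilMinimal τ u Ω)
    (hbd : ∀ p ∈ frontier Ω, u p = τ * p.1 * p.2) :
    NilMinimal τ (fun p => τ * p.1 * p.2) Set.univ ∧
      ∀ p ∈ Ω, u p = τ * p.1 * p.2 := by
  refine ⟨nilMinimal_invariant τ, fun p hp => le_antisymm
    (hmin.le_of_frontier hΩo hΩs hu hu0 hbd hp) ?_⟩
  have : -u p ≤ -τ * p.1 * p.2 := hmin.neg.le_of_frontier hΩo hΩs hu.neg hu0.neg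
    (fun q hq => by simp [hbd q hq]) hp
  linarith

end
end

section
/- Let τ ∈ ℝ and a < b be real numbers. If u ∈ C²(ℝ × (a, b)) ∩ C⁰(ℝ × [a, b]) satisfies the Nil₃(τ) minimal graph equation on the strip ℝ × (a, b) and u(x, a) = u(x, b) = 0 for every x ∈ ℝ, then u ≡ 0. -/
noncomputable section

open Set Filter Topology MeasureTheory

/-- The open strip `ℝ × (a, b)`. -/
def openStrip (a b : ℝ) : Set (ℝ × ℝ) := {p : ℝ × ℝ | p.2 ∈ Set.Ioo a b}

theorem isOpen_openStrip (a b : ℝ) : IsOpen (openStrip a b) :=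
  isOpen_Ioo.preimage continuous_snd

theorem measurableSet_openStrip (a b : ℝ) : MeasurableSet (openStrip a b) :=
  (isOpen_openStrip a b).measurableSet

/-- A function whose values at points of the open strip near the complement are at most `ε`. -/
def SmallNearBoundary (a b ε : ℝ) (u : ℝ × ℝ → ℝ) : Prop :=
  ∀ p ∉ openStrip a b, ∀ᶠ q in 𝓝 p, q ∈ openStrip a b → u q ≤ ε

theorem smallNearBoundary_of_zero {a b ε : ℝ} (hε : 0 < ε) {u : ℝ × ℝ → ℝ}
    (hu0 : ContinuousOn u {p : ℝ × ℝ | p.2 ∈ Set.Icc a b})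
    (hbda : ∀ x : ℝ, u (x, a) = 0) (hbdb : ∀ x : ℝ, u (x, b) = 0) :
    SmallNearBoundary a b ε u := by
  intro p hp
  by_cases hpT : p ∈ {p : ℝ × ℝ | p.2 ∈ Set.Icc a b}
  · have hup : u p = 0 := by
      obtain ⟨x, y⟩ := p
      have h1 : y ∈ Set.Icc a b := hpT
      have h2 : ¬ y ∈ Set.Ioo a b := hp
      rcases eq_or_lt_of_le h1.1 with h | h
      · rw [← h]; exact hbda x
      · rcases eq_or_lt_of_le h1.2 with h' | h'
        · rw [h']; exact hbdb x
        · exact absurd ⟨h, h'⟩ h2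
    have h : ∀ᶠ q in 𝓝[{p : ℝ × ℝ | p.2 ∈ Set.Icc a b}] p, u q < ε :=
      Filter.Tendsto.eventually_lt_const (by rw [hup]; exact hε) (hu0 p hpT)
    rw [eventually_nhdsWithin_iff] at h
    filter_upwards [h] with q hq hqS
    exact (hq (Set.Ioo_subset_Icc_self hqS)).le
  · have hcl : IsClosed {p : ℝ × ℝ | p.2 ∈ Set.Icc a b} := isClosed_Icc.preimage continuous_snd
    filter_upwards [hcl.isOpen_compl.mem_nhds hpT] with q hq hqS
    exact absurd (Set.Ioo_subset_Icc_self hqS) hq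

theorem indicator_eventuallyEq_zero {a b ε : ℝ} {u : ℝ × ℝ → ℝ}
    (hZ : SmallNearBoundary a b ε u) {k ζ : ℝ → ℝ} (hk0 : ∀ t ≤ ε, k t = 0)
    (g : ℝ × ℝ → ℝ) {p : ℝ × ℝ} (hp : p ∉ openStrip a b) :
    (openStrip a b).indicator (fun p => ζ p.1 * k (u p) * g p) =ᶠ[𝓝 p] fun _ => 0 := by
  filter_upwards [hZ p hp] with q hq
  by_cases hqS : q ∈ openStrip a b
  · simp [hqS, hk0 _ (hq hqS)]
  · simp [hqS]

theorem indicator_eventuallyEq_self {a b : ℝ} (f : ℝ × ℝ → ℝ) {p : ℝ × ℝ}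
    (hp : p ∈ openStrip a b) : (openStrip a b).indicator f =ᶠ[𝓝 p] f := by
  filter_upwards [(isOpen_openStrip a b).mem_nhds hp] with q hq
  simp [hq]

theorem contDiff_indicator_cutoff {n : WithTop ℕ∞} {a b ε : ℝ} {u : ℝ × ℝ → ℝ}
    (hZ : SmallNearBoundary a b ε u) (hu : ContDiffOn ℝ n u (openStrip a b))
    {k ζ : ℝ → ℝ} (hk : ContDiff ℝ n k) (hk0 : ∀ t ≤ ε, k t = 0) (hζ : ContDiff ℝ n ζ)
    {g : ℝ × ℝ → ℝ} (hg : ContDiffOn ℝ n g (openStrip a b)) :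
    ContDiff ℝ n ((openStrip a b).indicator (fun p => ζ p.1 * k (u p) * g p)) := by
  rw [contDiff_iff_contDiffAt]
  intro p
  by_cases hp : p ∈ openStrip a b
  · refine ContDiffAt.congr_of_eventuallyEq ?_ (indicator_eventuallyEq_self _ hp)
    have hn := (isOpen_openStrip a b).mem_nhds hp
    have h1 := hu.contDiffAt hn
    have h2 := hg.contDiffAt hn
    exact ((hζ.contDiffAt.comp p contDiffAt_fst).mul (hk.contDiffAt.comp p h1)).mul h2
  · exact ContDiffAt.congr_of_eventuallyEq contDiffAt_const (indicator_eventuallyEq_zero hZ hk0 g hp)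

theorem hasCompactSupport_indicator_cutoff {a b R : ℝ} {ζ : ℝ → ℝ} (hR : ∀ x, R ≤ |x| → ζ x = 0)
    (f : ℝ × ℝ → ℝ) :
    HasCompactSupport ((openStrip a b).indicator (fun p => ζ p.1 * f p)) := by
  refine HasCompactSupport.intro ((isCompact_Icc (a := -R) (b := R)).prod
    (isCompact_Icc (a := a) (b := b))) ?_
  intro p hp
  by_cases hpS : p ∈ openStrip a b
  · have : R ≤ |p.1| := by
      by_contra! h
      exact hp ⟨⟨(abs_lt.1 h).1.le, (abs_lt.1 h).2.le⟩, Set.Ioo_subset_Icc_self hpS⟩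
    simp [hR _ this]
  · simp [hpS]

theorem continuous_indicator_cutoff {a b ε : ℝ} {u : ℝ × ℝ → ℝ}
    (hZ : SmallNearBoundary a b ε u) (hu : ContinuousOn u (openStrip a b))
    {k ζ : ℝ → ℝ} (hk : Continuous k) (hk0 : ∀ t ≤ ε, k t = 0) (hζ : Continuous ζ)
    {g : ℝ × ℝ → ℝ} (hg : ContinuousOn g (openStrip a b)) :
    Continuous ((openStrip a b).indicator (fun p => ζ p.1 * k (u p) * g p)) := by
  rw [← contDiff_zero (𝕜 := ℝ)] at *
  exact contDiff_indicator_cutoff hZ (contDiffOn_zero.2 hu) hk hk0 hζ (contDiffOn_zero.2 hg)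

theorem integrableOn_cutoff {a b ε R : ℝ} {u : ℝ × ℝ → ℝ}
    (hZ : SmallNearBoundary a b ε u) (hu : ContinuousOn u (openStrip a b))
    {k ζ : ℝ → ℝ} (hk : Continuous k) (hk0 : ∀ t ≤ ε, k t = 0) (hζ : Continuous ζ)
    (hR : ∀ x, R ≤ |x| → ζ x = 0)
    {g : ℝ × ℝ → ℝ} (hg : ContinuousOn g (openStrip a b)) :
    IntegrableOn (fun p => ζ p.1 * k (u p) * g p) (openStrip a b) := by
  rw [← integrable_indicator_iff (measurableSet_openStrip a b)]
  refine (continuous_indicator_cutoff hZ hu hk hk0 hζ hg).integrable_of_hasCompactSupport ?_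
  simp only [mul_assoc]
  exact hasCompactSupport_indicator_cutoff hR _

theorem integral_fderiv_apply_eq_zero {F : ℝ × ℝ → ℝ} (hF : ContDiff ℝ 1 F)
    (hc : HasCompactSupport F) (v : ℝ × ℝ) : ∫ p, fderiv ℝ F p v = 0 := by
  have hFd : Continuous fun p => fderiv ℝ F p v :=
    (hF.continuous_fderiv one_ne_zero).clm_apply continuous_const
  have h := integral_mul_fderiv_eq_neg_fderiv_mul_of_integrable (μ := (volume : Measure (ℝ × ℝ)))
    (f := fun _ => (1 : ℝ)) (g := F) (v := v) (by simp)
    (by simpa using hFd.integrable_of_hasCompactSupport (hc.fderiv_apply (𝕜 := ℝ) v))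
    (by simpa using hF.continuous.integrable_of_hasCompactSupport hc)
    (by fun_prop) (fun x _ => hF.differentiable one_ne_zero x)
  simpa using h

/-- A `C¹` function `k` of one variable with derivative `k'` vanishing on `(-∞, ε]`. -/
structure IsProfile (ε : ℝ) (k k' : ℝ → ℝ) : Prop where
  hasDerivAt : ∀ t, HasDerivAt k (k' t) t
  continuous_deriv : Continuous k'
  eq_zero : ∀ t ≤ ε, k t = 0
  deriv_eq_zero : ∀ t ≤ ε, k' t = 0

/-- A `C¹` function `ζ` of one variable with derivative `ζ'` vanishing outside `(-R, R)`. -/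
structure IsCutoff (R : ℝ) (ζ ζ' : ℝ → ℝ) : Prop where
  hasDerivAt : ∀ x, HasDerivAt ζ (ζ' x) x
  continuous_deriv : Continuous ζ'
  eq_zero : ∀ x, R ≤ |x| → ζ x = 0
  deriv_eq_zero : ∀ x, R ≤ |x| → ζ' x = 0

theorem contDiff_one_of_hasDerivAt {f f' : ℝ → ℝ} (h : ∀ t, HasDerivAt f (f' t) t)
    (hf' : Continuous f') : ContDiff ℝ 1 f := by
  rw [contDiff_one_iff_deriv]
  exact ⟨fun t => (h t).differentiableAt, by rwa [funext fun t => (h t).deriv]⟩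

theorem IsProfile.contDiff {ε : ℝ} {k k' : ℝ → ℝ} (h : IsProfile ε k k') : ContDiff ℝ 1 k :=
  contDiff_one_of_hasDerivAt h.hasDerivAt h.continuous_deriv

theorem IsCutoff.contDiff {R : ℝ} {ζ ζ' : ℝ → ℝ} (h : IsCutoff R ζ ζ') : ContDiff ℝ 1 ζ :=
  contDiff_one_of_hasDerivAt h.hasDerivAt h.continuous_deriv

theorem continuousOn_fderiv_apply {f : ℝ × ℝ → ℝ} {a b : ℝ}
    (hf : ContDiffOn ℝ 1 f (openStrip a b)) (v : ℝ × ℝ) :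
    ContinuousOn (fun p => fderiv ℝ f p v) (openStrip a b) :=
  (hf.continuousOn_fderiv_of_isOpen (isOpen_openStrip a b) le_rfl).clm_apply continuousOn_const

section Divergence

variable {a b ε R : ℝ} {u : ℝ × ℝ → ℝ} {k k' ζ ζ' : ℝ → ℝ}

theorem integral_directional_cutoff (hZ : SmallNearBoundary a b ε u)
    (hu : ContDiffOn ℝ 1 u (openStrip a b)) (hk : IsProfile ε k k') (hζ : IsCutoff R ζ ζ')
    {Y : ℝ × ℝ → ℝ} (hY : ContDiffOn ℝ 1 Y (openStrip a b)) (v : ℝ × ℝ) :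
    IntegrableOn (fun p => ζ' p.1 * k (u p) * (v.1 * Y p) +
      ζ p.1 * k' (u p) * (fderiv ℝ u p v * Y p) + ζ p.1 * k (u p) * fderiv ℝ Y p v)
      (openStrip a b) ∧
    ∫ p in openStrip a b, (ζ' p.1 * k (u p) * (v.1 * Y p) +
      ζ p.1 * k' (u p) * (fderiv ℝ u p v * Y p) + ζ p.1 * k (u p) * fderiv ℝ Y p v) = 0 := by
  have hF := contDiff_indicator_cutoff hZ hu hk.contDiff hk.eq_zero hζ.contDiff hY
  have hc : HasCompactSupport
      ((openStrip a b).indicator (fun p => ζ p.1 * k (u p) * Y p)) := by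
    simp only [mul_assoc]
    exact hasCompactSupport_indicator_cutoff hζ.eq_zero _
  have h0 := integral_fderiv_apply_eq_zero hF hc v
  refine ⟨?_, ?_⟩
  · have i1 := integrableOn_cutoff hZ hu.continuousOn hk.contDiff.continuous hk.eq_zero
      hζ.continuous_deriv hζ.deriv_eq_zero (g := fun p => v.1 * Y p)
      (continuousOn_const.mul hY.continuousOn)
    have i2 := integrableOn_cutoff hZ hu.continuousOn hk.continuous_deriv hk.deriv_eq_zero
      hζ.contDiff.continuous hζ.eq_zero (g := fun p => fderiv ℝ u p v * Y p)
      ((continuousOn_fderiv_apply hu v).mul hY.continuousOn)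
    have i3 := integrableOn_cutoff hZ hu.continuousOn hk.contDiff.continuous hk.eq_zero
      hζ.contDiff.continuous hζ.eq_zero (continuousOn_fderiv_apply hY v)
    exact (i1.add i2).add i3
  · rw [← integral_indicator (measurableSet_openStrip a b), ← h0]
    congr 1
    ext p
    by_cases hp : p ∈ openStrip a b
    · rw [Set.indicator_of_mem hp, (indicator_eventuallyEq_self _ hp).fderiv_eq]
      have hn := (isOpen_openStrip a b).mem_nhds hp
      have d1 : HasFDerivAt u (fderiv ℝ u p) p :=
        ((hu.contDiffAt hn).differentiableAt one_ne_zero).hasFDerivAt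
      have d2 : HasFDerivAt Y (fderiv ℝ Y p) p :=
        ((hY.contDiffAt hn).differentiableAt one_ne_zero).hasFDerivAt
      have d3 : HasFDerivAt (fun p : ℝ × ℝ => ζ p.1) _ p :=
        (hζ.hasDerivAt p.1).comp_hasFDerivAt p (hasFDerivAt_fst (𝕜 := ℝ) (p := p))
      have d4 : HasFDerivAt (fun p : ℝ × ℝ => k (u p)) _ p :=
        (hk.hasDerivAt (u p)).comp_hasFDerivAt p d1
      rw [((d3.fun_mul d4).fun_mul d2).fderiv]
      simp
      ring
    · rw [Set.indicator_of_notMem hp,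
        (indicator_eventuallyEq_zero hZ hk.eq_zero Y hp).fderiv_eq]
      simp

theorem integral_divergence_cutoff (hZ : SmallNearBoundary a b ε u)
    (hu : ContDiffOn ℝ 1 u (openStrip a b)) (hk : IsProfile ε k k') (hζ : IsCutoff R ζ ζ')
    {X Y d : ℝ × ℝ → ℝ} (hX : ContDiffOn ℝ 1 X (openStrip a b))
    (hY : ContDiffOn ℝ 1 Y (openStrip a b))
    (hd : ∀ p ∈ openStrip a b, fderiv ℝ X p (1, 0) + fderiv ℝ Y p (0, 1) = d p) :
    IntegrableOn (fun p => ζ' p.1 * k (u p) * X p +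
      ζ p.1 * k' (u p) * (fderiv ℝ u p (1, 0) * X p + fderiv ℝ u p (0, 1) * Y p) +
      ζ p.1 * k (u p) * d p) (openStrip a b) ∧
    ∫ p in openStrip a b, (ζ' p.1 * k (u p) * X p +
      ζ p.1 * k' (u p) * (fderiv ℝ u p (1, 0) * X p + fderiv ℝ u p (0, 1) * Y p) +
      ζ p.1 * k (u p) * d p) = 0 := by
  have h1 := integral_directional_cutoff hZ hu hk hζ hX (1, 0)
  have h2 := integral_directional_cutoff hZ hu hk hζ hY (0, 1)
  have e := integral_add h1.1 h2.1
  rw [h1.2, h2.2, add_zero] at e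
  refine ⟨(h1.1.add h2.1).congr_fun ?_ (measurableSet_openStrip a b),
    (setIntegral_congr_fun (measurableSet_openStrip a b) ?_).trans e⟩
  all_goals
    intro p hp
    simp only [Pi.add_apply]
    rw [← hd p hp]
    ring

end Divergence

section Field

variable {τ a b : ℝ} {u : ℝ × ℝ → ℝ}

theorem nilW_pos (τ : ℝ) (u : ℝ × ℝ → ℝ) (p : ℝ × ℝ) : 0 < nilW τ u p :=
  Real.sqrt_pos.2 (by positivity)

theorem nilW_sq (τ : ℝ) (u : ℝ × ℝ → ℝ) (p : ℝ × ℝ) :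
    nilW τ u p ^ 2 = 1 + nilAlpha τ u p ^ 2 + nilBeta τ u p ^ 2 :=
  Real.sq_sqrt (by positivity)

theorem contDiffOn_nilAlpha (hu : ContDiffOn ℝ 2 u (openStrip a b)) :
    ContDiffOn ℝ 1 (nilAlpha τ u) (openStrip a b) :=
  ((hu.fderiv_of_isOpen (isOpen_openStrip a b) (m := 1) (by norm_num)).clm_apply
    contDiffOn_const).add (contDiffOn_const.mul contDiff_snd.contDiffOn)

theorem contDiffOn_nilBeta (hu : ContDiffOn ℝ 2 u (openStrip a b)) :
    ContDiffOn ℝ 1 (nilBeta τ u) (openStrip a b) :=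
  ((hu.fderiv_of_isOpen (isOpen_openStrip a b) (m := 1) (by norm_num)).clm_apply
    contDiffOn_const).sub (contDiffOn_const.mul contDiff_fst.contDiffOn)

theorem contDiffOn_nilW (hu : ContDiffOn ℝ 2 u (openStrip a b)) :
    ContDiffOn ℝ 1 (nilW τ u) (openStrip a b) :=
  ((contDiffOn_const.add ((contDiffOn_nilAlpha hu).pow 2)).add
    ((contDiffOn_nilBeta hu).pow 2)).sqrt fun p _ =>
      (show 0 < 1 + nilAlpha τ u p ^ 2 + nilBeta τ u p ^ 2 by positivity).ne'

theorem contDiffOn_nilAlpha_div_nilW (hu : ContDiffOn ℝ 2 u (openStrip a b)) :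
    ContDiffOn ℝ 1 (fun p => nilAlpha τ u p / nilW τ u p) (openStrip a b) :=
  (contDiffOn_nilAlpha hu).div (contDiffOn_nilW hu) fun p _ => (nilW_pos τ u p).ne'

theorem contDiffOn_nilBeta_div_nilW (hu : ContDiffOn ℝ 2 u (openStrip a b)) :
    ContDiffOn ℝ 1 (fun p => nilBeta τ u p / nilW τ u p) (openStrip a b) :=
  (contDiffOn_nilBeta hu).div (contDiffOn_nilW hu) fun p _ => (nilW_pos τ u p).ne'

theorem nilAlpha_zero (τ : ℝ) (p : ℝ × ℝ) : nilAlpha τ (fun _ => 0) p = τ * p.2 := by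
  simp [nilAlpha]

theorem nilBeta_zero (τ : ℝ) (p : ℝ × ℝ) : nilBeta τ (fun _ => 0) p = -(τ * p.1) := by
  simp [nilBeta]

theorem nilMinimal_zero (τ : ℝ) (Ω : Set (ℝ × ℝ)) : NilMinimal τ (fun _ => 0) Ω := by
  intro p _
  have h1 : HasFDerivAt (fun q : ℝ × ℝ => τ * q.1) (τ • ContinuousLinearMap.fst ℝ ℝ ℝ) p :=
    (hasFDerivAt_fst (𝕜 := ℝ) (p := p)).const_mul τ
  have h2 : HasFDerivAt (fun q : ℝ × ℝ => τ * q.2) (τ • ContinuousLinearMap.snd ℝ ℝ ℝ) p :=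
    (hasFDerivAt_snd (𝕜 := ℝ) (p := p)).const_mul τ
  have hW : HasFDerivAt (fun q : ℝ × ℝ => √(1 + (τ * q.2) ^ 2 + (-(τ * q.1)) ^ 2)) _ p :=
    (((h2.pow 2).const_add 1).add (h1.neg.pow 2)).sqrt
      (show 0 < 1 + (τ * p.2) ^ 2 + (-(τ * p.1)) ^ 2 by positivity).ne'
  have hne : √(1 + (τ * p.2) ^ 2 + (-(τ * p.1)) ^ 2) ≠ 0 := by positivity
  simp only [nilW, nilAlpha_zero, nilBeta_zero]
  have hI : HasFDerivAt (fun q : ℝ × ℝ => (√(1 + (τ * q.2) ^ 2 + (-(τ * q.1)) ^ 2))⁻¹) _ p :=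
    (hasDerivAt_inv hne).comp_hasFDerivAt p hW
  simp only [div_eq_mul_inv]
  rw [(h2.fun_mul hI).fderiv, (h1.fun_neg.fun_mul hI).fderiv]
  simp
  ring

theorem nilMinimal_neg {Ω : Set (ℝ × ℝ)} (h : NilMinimal τ u Ω) :
    NilMinimal (-τ) (fun p => -u p) Ω := by
  have hα : ∀ q, nilAlpha (-τ) (fun p => -u p) q = -nilAlpha τ u q := by
    intro q
    simp [nilAlpha, fderiv_fun_neg]
    ring
  have hβ : ∀ q, nilBeta (-τ) (fun p => -u p) q = -nilBeta τ u q := by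
    intro q
    simp [nilBeta, fderiv_fun_neg]
    ring
  intro p hp
  have := h p hp
  simp only [nilW, hα, hβ, neg_sq, neg_div, fderiv_fun_neg, neg_apply] at this ⊢
  linarith

theorem flux_sub_identity {α β α₀ β₀ W V : ℝ} (hW : 0 < W) (hV : 0 < V)
    (hW2 : W ^ 2 = 1 + α ^ 2 + β ^ 2) (hV2 : V ^ 2 = 1 + α₀ ^ 2 + β₀ ^ 2) :
    (α - α₀) * (α / W - α₀ / V) + (β - β₀) * (β / W - β₀ / V) =
      (W + V) / 2 * ((α / W - α₀ / V) ^ 2 + (β / W - β₀ / V) ^ 2 + (1 / W - 1 / V) ^ 2) := by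
  field_simp
  have h1 : α ^ 2 = W ^ 2 - 1 - β ^ 2 := by linarith
  have h2 : α₀ ^ 2 = V ^ 2 - 1 - β₀ ^ 2 := by linarith
  ring_nf
  simp only [h1, h2]
  ring

theorem abs_div_sqrt_le_one {α β W : ℝ} (hW : 0 < W) (hW2 : W ^ 2 = 1 + α ^ 2 + β ^ 2) :
    |α / W| ≤ 1 := by
  rw [abs_div, abs_of_pos hW, div_le_one hW]
  exact abs_le_of_sq_le_sq (by nlinarith [sq_nonneg β]) hW.le

theorem flux_coercive {α β c d W : ℝ} (hW : 0 < W) (hW2 : W ^ 2 = 1 + α ^ 2 + β ^ 2) :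
    |β + d| - 2 * |d| - |c| - 1 ≤ (α - c) * (α / W) + (β + d) * (β / W) := by
  have hα := abs_div_sqrt_le_one hW hW2
  have hβ : |β / W| ≤ 1 := abs_div_sqrt_le_one hW (by linarith : W ^ 2 = 1 + β ^ 2 + α ^ 2)
  have e : (α - c) * (α / W) + (β + d) * (β / W) = W - 1 / W - c * (α / W) + d * (β / W) := by
    field_simp
    linarith
  have hW1 : 1 ≤ W := by nlinarith [sq_nonneg α, sq_nonneg β]
  have h1 : 1 / W ≤ 1 := by rw [div_le_one hW]; exact hW1
  have h2 : |β| ≤ W := abs_le_of_sq_le_sq (by nlinarith [sq_nonneg α]) hW.le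
  have h3 : |c * (α / W)| ≤ |c| := by
    rw [abs_mul]; exact mul_le_of_le_one_right (abs_nonneg c) hα
  have h4 : |d * (β / W)| ≤ |d| := by
    rw [abs_mul]; exact mul_le_of_le_one_right (abs_nonneg d) hβ
  have h5 := abs_add_le β d
  rw [e]
  linarith [le_abs_self (c * (α / W)), neg_abs_le (d * (β / W))]

end Field

section Truncation

/-- A bounded increasing `C¹` truncation at height `M` of the positive part of `s`. -/
def trunc (M s : ℝ) : ℝ := max s 0 ^ 2 / (1 + max s 0 + max s 0 ^ 2 / M)

/-- The derivative of `trunc M`. -/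
def truncDeriv (M s : ℝ) : ℝ :=
  (2 * max s 0 + max s 0 ^ 2) / (1 + max s 0 + max s 0 ^ 2 / M) ^ 2

variable {M s : ℝ}

theorem trunc_of_nonpos (h : s ≤ 0) : trunc M s = 0 := by simp [trunc, h]

theorem truncDeriv_of_nonpos (h : s ≤ 0) : truncDeriv M s = 0 := by simp [truncDeriv, h]

theorem trunc_denom_pos (hM : 0 < M) (s : ℝ) : 0 < 1 + max s 0 + max s 0 ^ 2 / M := by
  positivity

theorem continuous_trunc (hM : 0 < M) : Continuous (trunc M) := by
  unfold trunc
  exact Continuous.div (by fun_prop) (by fun_prop) fun s => (trunc_denom_pos hM s).ne'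

theorem continuous_truncDeriv (hM : 0 < M) : Continuous (truncDeriv M) := by
  unfold truncDeriv
  exact Continuous.div (by fun_prop) (by fun_prop) fun s =>
    (pow_pos (trunc_denom_pos hM s) 2).ne'

theorem hasDerivAt_trunc (hM : 0 < M) (s : ℝ) : HasDerivAt (trunc M) (truncDeriv M s) s := by
  refine hasDerivAt_of_hasDerivAt_of_ne' (x := 0) ?_ (continuous_trunc hM).continuousAt
    (continuous_truncDeriv hM).continuousAt s
  intro y hy
  rcases lt_or_gt_of_ne hy with h | h
  · rw [truncDeriv_of_nonpos h.le]
    refine (hasDerivAt_const y (0 : ℝ)).congr_of_eventuallyEq ?_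
    filter_upwards [Iio_mem_nhds h] with t ht using trunc_of_nonpos (le_of_lt ht)
  · have hD : 0 < 1 + y + y ^ 2 / M := by positivity
    have hd : HasDerivAt (fun t : ℝ => t ^ 2 / (1 + t + t ^ 2 / M)) _ y :=
      (hasDerivAt_pow 2 y).fun_div
        (((hasDerivAt_id' y).const_add 1).fun_add ((hasDerivAt_pow 2 y).div_const M)) hD.ne'
    have hd' := hd.congr_of_eventuallyEq (f₁ := trunc M) (by
      filter_upwards [Ioi_mem_nhds h] with t ht
      simp [trunc, max_eq_left (le_of_lt (Set.mem_Ioi.1 ht))])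
    convert hd' using 1
    rw [truncDeriv, max_eq_left h.le]
    congr 1
    push_cast
    field_simp
    ring

theorem trunc_nonneg (hM : 0 < M) (s : ℝ) : 0 ≤ trunc M s := by unfold trunc; positivity

theorem truncDeriv_nonneg (hM : 0 < M) (s : ℝ) : 0 ≤ truncDeriv M s := by
  unfold truncDeriv; positivity

theorem truncDeriv_le_one (hM : 0 < M) (s : ℝ) : truncDeriv M s ≤ 1 := by
  have h0 : 0 ≤ max s 0 := le_max_right s 0
  have h1 : 0 ≤ max s 0 ^ 2 / M := by positivity
  rw [truncDeriv, div_le_one (pow_pos (trunc_denom_pos hM s) 2)]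
  nlinarith [mul_nonneg h0 h1]

theorem trunc_le (hM : 0 < M) (s : ℝ) : trunc M s ≤ M := by
  rw [trunc, div_le_iff₀ (trunc_denom_pos hM s)]
  have : M * (1 + max s 0 + max s 0 ^ 2 / M) = M * (1 + max s 0) + max s 0 ^ 2 := by
    field_simp
  rw [this]
  have : 0 ≤ M * (1 + max s 0) := by positivity
  linarith

theorem le_trunc_of_le (hs : 0 ≤ s) (hsM : s ≤ M) (hM : 0 < M) : s ≤ 2 * (1 + trunc M s) := by
  have h1 : s ^ 2 / M ≤ s := by rw [div_le_iff₀ hM]; nlinarith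
  have h2 : s ^ 2 / (1 + s + s) ≤ trunc M s := by
    rw [trunc, max_eq_left hs]
    exact div_le_div_of_nonneg_left (by positivity) (by positivity) (by linarith)
  have h3 : s ≤ 2 * (1 + s ^ 2 / (1 + s + s)) := by
    have : 2 * (1 + s ^ 2 / (1 + s + s)) = (2 + 4 * s + 2 * s ^ 2) / (1 + s + s) := by
      field_simp; ring
    rw [this, le_div_iff₀ (by positivity)]
    nlinarith
  linarith

theorem le_trunc_of_ge (hM : 1 ≤ M) (hsM : M ≤ s) : M ≤ 3 * trunc M s := by
  have hM0 : 0 < M := by linarith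
  have hs : 0 < s := by linarith
  rw [trunc, max_eq_left hs.le, mul_div_assoc', le_div_iff₀ (by positivity)]
  have : M * (1 + s + s ^ 2 / M) = M * (1 + s) + s ^ 2 := by field_simp
  rw [this]
  nlinarith

/-- A truncation, bounded by `2`, whose derivative is not too small up to height `M`. -/
def slowTrunc (M s : ℝ) : ℝ := trunc 1 s + trunc M s / M

/-- The derivative of `slowTrunc M`. -/
def slowTruncDeriv (M s : ℝ) : ℝ := truncDeriv 1 s + truncDeriv M s / M

theorem slowTrunc_nonneg (hM : 0 < M) (s : ℝ) : 0 ≤ slowTrunc M s :=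
  add_nonneg (trunc_nonneg one_pos s) (div_nonneg (trunc_nonneg hM s) hM.le)

theorem slowTrunc_le_two (hM : 0 < M) (s : ℝ) : slowTrunc M s ≤ 2 := by
  have h1 := trunc_le one_pos s
  have h2 : trunc M s / M ≤ 1 := by rw [div_le_one hM]; exact trunc_le hM s
  unfold slowTrunc
  linarith

theorem truncDeriv_one_le_slowTruncDeriv (hM : 0 < M) (s : ℝ) :
    truncDeriv 1 s ≤ slowTruncDeriv M s :=
  le_add_of_nonneg_right (div_nonneg (truncDeriv_nonneg hM s) hM.le)

theorem slowTruncDeriv_nonneg (hM : 0 < M) (s : ℝ) : 0 ≤ slowTruncDeriv M s :=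
  (truncDeriv_nonneg one_pos s).trans (truncDeriv_one_le_slowTruncDeriv hM s)

theorem slowTrunc_sq_le {K : ℝ} (hK : 1 ≤ K) (hs : 0 ≤ s) (hsK : s ≤ K ^ 2) :
    slowTrunc (K ^ 2) s ^ 2 ≤ 6 * s * K * slowTruncDeriv (K ^ 2) s := by
  set M := K ^ 2 with hMdef
  have hM1 : 1 ≤ M := by rw [hMdef]; nlinarith
  have hM : 0 < M := by linarith
  set p := trunc 1 s with hp
  set q := trunc M s / M with hq
  set p' := truncDeriv 1 s with hp'
  set q' := truncDeriv M s / M with hq'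
  have hp0 : 0 ≤ p := trunc_nonneg one_pos s
  have hp'0 : 0 ≤ p' := truncDeriv_nonneg one_pos s
  have hq'0 : 0 ≤ q' := div_nonneg (truncDeriv_nonneg hM s) hM.le
  have ep : p = s ^ 2 / (1 + s + s ^ 2) := by rw [hp, trunc, max_eq_left hs, div_one]
  have ep' : p' = (2 * s + s ^ 2) / (1 + s + s ^ 2) ^ 2 := by
    rw [hp', truncDeriv, max_eq_left hs, div_one]
  have eq : q = s ^ 2 / (M + M * s + s ^ 2) := by
    rw [hq, trunc, max_eq_left hs]; field_simp
  have eq' : q' = M * (2 * s + s ^ 2) / (M + M * s + s ^ 2) ^ 2 := by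
    rw [hq', truncDeriv, max_eq_left hs]; field_simp
  have h1 : p ^ 2 ≤ s ^ 2 * p' := by
    rw [ep, ep', div_pow, mul_div_assoc']
    gcongr
    nlinarith [pow_nonneg hs 3]
  have h2 : p ^ 2 ≤ 4 * M * q' := by
    have hD : M + M * s + s ^ 2 ≤ M * (1 + 2 * s) := by nlinarith
    have hq'' : M * (2 * s + s ^ 2) / (M * (1 + 2 * s)) ^ 2 ≤ q' := by
      rw [eq']; gcongr
    have e : 4 * M * (M * (2 * s + s ^ 2) / (M * (1 + 2 * s)) ^ 2) =
        4 * (2 * s + s ^ 2) / (1 + 2 * s) ^ 2 := by field_simp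
    have h : p ^ 2 ≤ 4 * (2 * s + s ^ 2) / (1 + 2 * s) ^ 2 := by
      rw [ep, div_pow, div_le_div_iff₀ (by positivity) (by positivity)]
      have hx : (s * (1 + 2 * s)) ^ 2 ≤ (2 * (1 + s + s ^ 2)) ^ 2 :=
        pow_le_pow_left₀ (by positivity) (by nlinarith) 2
      calc (s ^ 2) ^ 2 * (1 + 2 * s) ^ 2 = s ^ 2 * (s * (1 + 2 * s)) ^ 2 := by ring
        _ ≤ (2 * s + s ^ 2) * (2 * (1 + s + s ^ 2)) ^ 2 := by
          apply mul_le_mul _ hx <;> first | positivity | nlinarith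
        _ = _ := by ring
    calc p ^ 2 ≤ _ := h
      _ = _ := e.symm
      _ ≤ _ := by gcongr
  have h3 : q ^ 2 ≤ s * q' := by
    rw [eq, eq', div_pow, mul_div_assoc']
    gcongr
    nlinarith [pow_nonneg hs 3, mul_nonneg (pow_nonneg hs 3) (sub_nonneg.2 hsK),
      mul_nonneg hM.le (pow_nonneg hs 2)]
  have h4 : p ^ 2 ≤ 2 * s * K * (p' + q') := by
    refine abs_le_of_sq_le_sq' ?_ (by positivity) |>.2
    calc (p ^ 2) ^ 2 = p ^ 2 * p ^ 2 := by ring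
      _ ≤ (s ^ 2 * p') * (4 * M * q') := by gcongr
      _ = 4 * s ^ 2 * K ^ 2 * (p' * q') := by rw [hMdef]; ring
      _ ≤ 4 * s ^ 2 * K ^ 2 * (p' + q') ^ 2 := by
        gcongr; nlinarith
      _ = _ := by ring
  have h5 : s * q' ≤ s * K * (p' + q') := by
    have : q' ≤ K * (p' + q') := by nlinarith
    calc s * q' ≤ s * (K * (p' + q')) := by gcongr
      _ = _ := by ring
  show (p + q) ^ 2 ≤ 6 * s * K * (p' + q')
  nlinarith [sq_nonneg (p - q)]

theorem isProfile_trunc (ε : ℝ) (hM : 0 < M) :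
    IsProfile ε (fun t => trunc M (t - ε)) (fun t => truncDeriv M (t - ε)) where
  hasDerivAt t := by simpa using (hasDerivAt_trunc hM (t - ε)).comp_sub_const t ε
  continuous_deriv := (continuous_truncDeriv hM).comp (by fun_prop)
  eq_zero t ht := trunc_of_nonpos (sub_nonpos.2 ht)
  deriv_eq_zero t ht := truncDeriv_of_nonpos (sub_nonpos.2 ht)

theorem isProfile_slowTrunc (ε : ℝ) (hM : 0 < M) :
    IsProfile ε (fun t => slowTrunc M (t - ε)) (fun t => slowTruncDeriv M (t - ε)) where
  hasDerivAt t := ((isProfile_trunc ε one_pos).hasDerivAt t).fun_add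
    (((isProfile_trunc ε hM).hasDerivAt t).div_const M)
  continuous_deriv := (isProfile_trunc ε one_pos).continuous_deriv.add
    ((isProfile_trunc ε hM).continuous_deriv.div_const M)
  eq_zero t ht := by simp [slowTrunc, trunc_of_nonpos (sub_nonpos.2 ht)]
  deriv_eq_zero t ht := by simp [slowTruncDeriv, truncDeriv_of_nonpos (sub_nonpos.2 ht)]

end Truncation

section Cutoff

theorem exists_cutoff : ∃ (η η' : ℝ → ℝ) (C : ℝ), IsCutoff 2 η η' ∧ (∀ x, 0 ≤ η x) ∧
    (∀ x, η x ≤ 1) ∧ (∀ x, |x| ≤ 1 → η x = 1) ∧ (∀ x, |x| < 1 → η' x = 0) ∧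
    0 < C ∧ ∀ x, |η' x| ≤ C := by
  let f : ContDiffBump (0 : ℝ) := ⟨1, 2, one_pos, one_lt_two⟩
  have hf : ContDiff ℝ 1 f := f.contDiff
  have hd : Continuous (deriv f) := hf.continuous_deriv le_rfl
  have hz : ∀ x, 2 ≤ |x| → f x = 0 := fun x hx =>
    f.zero_of_le_dist (by simpa [Real.dist_eq] using hx)
  have hone : ∀ x, |x| ≤ 1 → f x = 1 := fun x hx =>
    f.one_of_mem_closedBall (by simpa [Real.dist_eq] using hx)
  obtain ⟨C, hC⟩ := hd.bounded_above_of_compact_support f.hasCompactSupport.deriv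
  refine ⟨f, deriv f, max C 1,
    ⟨fun x => (hf.differentiable one_ne_zero x).hasDerivAt, hd, hz, fun x hx => ?_⟩,
    fun x => f.nonneg, fun x => f.le_one, hone, fun x hx => ?_,
    by positivity, fun x => (hC x).trans (le_max_left _ _)⟩
  · have hmin : IsLocalMin f x := Filter.Eventually.of_forall fun y => by
      rw [hz x hx]; exact f.nonneg
    exact hmin.deriv_eq_zero
  · have hmax : IsLocalMax f x := Filter.Eventually.of_forall fun y => by
      rw [hone x hx.le]; exact f.le_one
    exact hmax.deriv_eq_zero

variable {R : ℝ} {η η' : ℝ → ℝ}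

theorem IsCutoff.comp_div (h : IsCutoff R η η') {ρ : ℝ} (hρ : 0 < ρ) :
    IsCutoff (R * ρ) (fun x => η (x / ρ)) (fun x => η' (x / ρ) / ρ) where
  hasDerivAt x := by
    simpa [div_eq_mul_inv, Function.comp_def] using
      (h.hasDerivAt (x / ρ)).comp x ((hasDerivAt_id x).div_const ρ)
  continuous_deriv := (h.continuous_deriv.comp (by fun_prop)).div_const ρ
  eq_zero x hx := h.eq_zero _ (by rwa [abs_div, abs_of_pos hρ, le_div_iff₀ hρ])
  deriv_eq_zero x hx := by
    rw [h.deriv_eq_zero _ (by rwa [abs_div, abs_of_pos hρ, le_div_iff₀ hρ]), zero_div]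

theorem IsCutoff.sq (h : IsCutoff R η η') :
    IsCutoff R (fun x => η x ^ 2) (fun x => 2 * η x * η' x) where
  hasDerivAt x := by simpa using (h.hasDerivAt x).fun_pow 2
  continuous_deriv := (continuous_const.mul h.contDiff.continuous).mul h.continuous_deriv
  eq_zero x hx := by simp [h.eq_zero x hx]
  deriv_eq_zero x hx := by simp [h.eq_zero x hx]

end Cutoff

section Energy

/-- The inner product of the difference of the fluxes of `u` and of the zero function with `∇u`. -/
def fluxEnergy (τ : ℝ) (u : ℝ × ℝ → ℝ) (p : ℝ × ℝ) : ℝ :=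
  fderiv ℝ u p (1, 0) *
      (nilAlpha τ u p / nilW τ u p - nilAlpha τ (fun _ => 0) p / nilW τ (fun _ => 0) p) +
    fderiv ℝ u p (0, 1) *
      (nilBeta τ u p / nilW τ u p - nilBeta τ (fun _ => 0) p / nilW τ (fun _ => 0) p)

theorem fluxEnergy_eq (τ : ℝ) (u : ℝ × ℝ → ℝ) (p : ℝ × ℝ) :
    fluxEnergy τ u p = (nilW τ u p + nilW τ (fun _ => 0) p) / 2 *
      ((nilAlpha τ u p / nilW τ u p - nilAlpha τ (fun _ => 0) p / nilW τ (fun _ => 0) p) ^ 2 +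
        (nilBeta τ u p / nilW τ u p - nilBeta τ (fun _ => 0) p / nilW τ (fun _ => 0) p) ^ 2 +
        (1 / nilW τ u p - 1 / nilW τ (fun _ => 0) p) ^ 2) := by
  rw [← flux_sub_identity (nilW_pos τ u p) (nilW_pos τ (fun _ => 0) p) (nilW_sq τ u p)
    (nilW_sq τ (fun _ => 0) p), fluxEnergy]
  congr 2
  · rw [nilAlpha_zero, nilAlpha]; ring
  · rw [nilBeta_zero, nilBeta]; ring

theorem fluxEnergy_nonneg (τ : ℝ) (u : ℝ × ℝ → ℝ) (p : ℝ × ℝ) : 0 ≤ fluxEnergy τ u p := by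
  rw [fluxEnergy_eq]
  have := nilW_pos τ u p
  have := nilW_pos τ (fun _ => 0) p
  positivity

theorem le_fluxEnergy {τ ρ : ℝ} (hρ : 0 ≤ ρ) (u : ℝ × ℝ → ℝ) {p : ℝ × ℝ} (hp : ρ ≤ |p.1|) :
    (1 + |τ| * ρ) / 4 * (nilAlpha τ u p / nilW τ u p -
      nilAlpha τ (fun _ => 0) p / nilW τ (fun _ => 0) p) ^ 2 ≤ fluxEnergy τ u p := by
  rw [fluxEnergy_eq]
  have h1 := nilW_pos τ u p
  have h2 := nilW_pos τ (fun _ => 0) p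
  have h3 : (1 + |τ| * ρ) / 2 ≤ nilW τ (fun _ => 0) p := by
    refine abs_le_of_sq_le_sq' ?_ h2.le |>.2
    rw [nilW_sq, nilAlpha_zero, nilBeta_zero]
    have h4 : (|τ| * ρ) ^ 2 ≤ (τ * p.1) ^ 2 := by
      rw [← sq_abs (τ * p.1), abs_mul]
      gcongr
    nlinarith [sq_nonneg (τ * p.2), sq_nonneg (|τ| * ρ - 1)]
  apply mul_le_mul
  · linarith
  · have := sq_nonneg
      (nilBeta τ u p / nilW τ u p - nilBeta τ (fun _ => 0) p / nilW τ (fun _ => 0) p)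
    have := sq_nonneg (1 / nilW τ u p - 1 / nilW τ (fun _ => 0) p)
    linarith
  · positivity
  · positivity

theorem fderiv_snd_eq_zero_of_fluxEnergy_eq_zero {τ : ℝ} {u : ℝ × ℝ → ℝ} {p : ℝ × ℝ}
    (h : fluxEnergy τ u p = 0) : fderiv ℝ u p (0, 1) = 0 := by
  have h1 := nilW_pos τ u p
  have h2 := nilW_pos τ (fun _ => 0) p
  rw [fluxEnergy_eq] at h
  have h3 := (mul_eq_zero.1 h).resolve_left (by positivity)
  set A := nilAlpha τ u p / nilW τ u p - nilAlpha τ (fun _ => 0) p / nilW τ (fun _ => 0) p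
  set B := nilBeta τ u p / nilW τ u p - nilBeta τ (fun _ => 0) p / nilW τ (fun _ => 0) p with hB
  set D := 1 / nilW τ u p - 1 / nilW τ (fun _ => 0) p with hD
  have hB0 : B = 0 := pow_eq_zero_iff two_ne_zero |>.1
    (by nlinarith [sq_nonneg A, sq_nonneg B, sq_nonneg D])
  have hD0 : D = 0 := pow_eq_zero_iff two_ne_zero |>.1
    (by nlinarith [sq_nonneg A, sq_nonneg B, sq_nonneg D])
  have hW : nilW τ u p = nilW τ (fun _ => 0) p := by
    rw [hD, sub_eq_zero, one_div, one_div] at hD0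
    exact inv_injective hD0
  rw [hB, hW, ← sub_div, div_eq_zero_iff, or_iff_left h2.ne', nilBeta_zero, nilBeta] at hB0
  linarith

theorem abs_flux_sub_le_two (τ : ℝ) (u : ℝ × ℝ → ℝ) (p : ℝ × ℝ) :
    |nilAlpha τ u p / nilW τ u p - nilAlpha τ (fun _ => 0) p / nilW τ (fun _ => 0) p| ≤ 2 := by
  have h1 := abs_div_sqrt_le_one (nilW_pos τ u p) (nilW_sq τ u p)
  have h2 := abs_div_sqrt_le_one (nilW_pos τ (fun _ => 0) p) (nilW_sq τ (fun _ => 0) p)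
  exact (abs_sub _ _).trans (by linarith)

theorem cutoff_energy_pointwise {ζ z Δ D q s K c : ℝ} (hζ0 : 0 ≤ ζ) (hζ1 : ζ ≤ 1) (hz : |z| ≤ c)
    (hΔ : |Δ| ≤ 2) (hq : 0 < q) (hD0 : 0 ≤ D) (hD : z ≠ 0 → q / 4 * Δ ^ 2 ≤ D) (hK : 1 ≤ K) :
    1 / 2 * (ζ ^ 2 * slowTruncDeriv (K ^ 2) s * D) ≤
      2 * ζ * z * slowTrunc (K ^ 2) s * Δ + ζ ^ 2 * slowTruncDeriv (K ^ 2) s * D +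
        (96 * c ^ 2 * K / q * (1 + trunc (K ^ 2) s) + 24 * c / K ^ 2 * trunc (K ^ 2) s) := by
  have hM1 : 1 ≤ K ^ 2 := one_le_pow₀ hK
  have hM : 0 < K ^ 2 := by positivity
  have hc : 0 ≤ c := (abs_nonneg z).trans hz
  have hv := trunc_nonneg hM s
  have hk := slowTrunc_nonneg hM s
  have hk2 := slowTrunc_le_two hM s
  have hk' := slowTruncDeriv_nonneg hM s
  set k := slowTrunc (K ^ 2) s with hkdef
  set k' := slowTruncDeriv (K ^ 2) s
  set v := trunc (K ^ 2) s
  have hJ : 0 ≤ ζ ^ 2 * k' * D := by positivity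
  have hE1 : 0 ≤ 96 * c ^ 2 * K / q * (1 + v) := by positivity
  have hE2 : 0 ≤ 24 * c / K ^ 2 * v := by positivity
  by_cases hz0 : z = 0
  · rw [hz0]; linarith
  by_cases hs : s ≤ 0
  · have : k = 0 := by simp [hkdef, slowTrunc, trunc_of_nonpos hs]
    rw [this]; linarith
  push Not at hs
  rcases le_total s (K ^ 2) with hsM | hsM
  · have hsv : s ≤ 2 * (1 + v) := le_trunc_of_le hs.le hsM hM
    have hsq : k ^ 2 ≤ 6 * s * K * k' := slowTrunc_sq_le hK hs.le hsM
    have hz2 : z ^ 2 ≤ c ^ 2 := by rw [← sq_abs z]; gcongr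
    have key : |2 * ζ * z * k * Δ| ≤
        1 / 2 * (ζ ^ 2 * k' * (q / 4 * Δ ^ 2)) + 48 * c ^ 2 * s * K / q := by
      refine abs_le_of_sq_le_sq ?_ (by positivity)
      calc (2 * ζ * z * k * Δ) ^ 2 = 4 * (ζ * Δ) ^ 2 * (z ^ 2 * k ^ 2) := by ring
        _ ≤ 4 * (ζ * Δ) ^ 2 * (c ^ 2 * (6 * s * K * k')) := by gcongr
        _ = 4 * (1 / 2 * (ζ ^ 2 * k' * (q / 4 * Δ ^ 2))) * (48 * c ^ 2 * s * K / q) := by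
          field_simp; ring
        _ ≤ _ := four_mul_le_sq_add _ _
    have h1 : 1 / 2 * (ζ ^ 2 * k' * (q / 4 * Δ ^ 2)) ≤ 1 / 2 * (ζ ^ 2 * k' * D) := by
      have := hD hz0
      gcongr
    have h2 : 48 * c ^ 2 * s * K / q ≤ 96 * c ^ 2 * K / q * (1 + v) := by
      calc 48 * c ^ 2 * s * K / q ≤ 48 * c ^ 2 * (2 * (1 + v)) * K / q := by gcongr
        _ = _ := by ring
    linarith [neg_abs_le (2 * ζ * z * k * Δ)]
  · have hMv : K ^ 2 ≤ 3 * v := le_trunc_of_ge hM1 hsM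
    have h1 : |2 * ζ * z * k * Δ| ≤ 2 * 1 * c * 2 * 2 := by
      simp only [abs_mul, abs_two, abs_of_nonneg hζ0, abs_of_nonneg hk]
      gcongr
    have h2 : 8 * c ≤ 24 * c / K ^ 2 * v := by
      rw [div_mul_eq_mul_div, le_div_iff₀ hM]
      nlinarith
    linarith [neg_abs_le (2 * ζ * z * k * Δ)]

end Energy

section Estimates

/-- The box `[-R, R] × (a, b)`. -/
def stripBox (a b R : ℝ) : Set (ℝ × ℝ) := Set.Icc (-R) R ×ˢ Set.Ioo a b

theorem stripBox_subset (a b R : ℝ) : stripBox a b R ⊆ openStrip a b := fun _ hp => hp.2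

theorem measurableSet_stripBox (a b R : ℝ) : MeasurableSet (stripBox a b R) :=
  measurableSet_Icc.prod measurableSet_Ioo

theorem volume_stripBox (a b R : ℝ) :
    volume (stripBox a b R) = ENNReal.ofReal (2 * R) * ENNReal.ofReal (b - a) := by
  rw [stripBox, Measure.volume_eq_prod, Measure.prod_prod, Real.volume_Icc, Real.volume_Ioo]
  congr 2
  ring

theorem volume_stripBox_lt_top (a b R : ℝ) : volume (stripBox a b R) < ⊤ := by
  rw [volume_stripBox]
  exact ENNReal.mul_lt_top ENNReal.ofReal_lt_top ENNReal.ofReal_lt_top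

theorem setIntegral_const_stripBox {a b R : ℝ} (hab : a ≤ b) (hR : 0 ≤ R) (c : ℝ) :
    ∫ _ in stripBox a b R, c = 2 * R * (b - a) * c := by
  rw [setIntegral_const, smul_eq_mul, Measure.real, volume_stripBox, ENNReal.toReal_mul,
    ENNReal.toReal_ofReal (by positivity), ENNReal.toReal_ofReal (by linarith)]

theorem le_abs_of_mem_openStrip_diff_stripBox {a b R : ℝ} {p : ℝ × ℝ}
    (hp : p ∈ openStrip a b \ stripBox a b R) : R ≤ |p.1| := by
  by_contra! h
  exact hp.2 ⟨⟨(abs_lt.1 h).1.le, (abs_lt.1 h).2.le⟩, hp.1⟩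

theorem setIntegral_stripBox_eq {a b R : ℝ} {f : ℝ × ℝ → ℝ}
    (hf : ∀ p : ℝ × ℝ, R ≤ |p.1| → f p = 0) :
    ∫ p in stripBox a b R, f p = ∫ p in openStrip a b, f p :=
  (setIntegral_eq_of_subset_of_forall_sdiff_eq_zero (measurableSet_openStrip a b)
    (stripBox_subset a b R) fun p hp => hf p (le_abs_of_mem_openStrip_diff_stripBox hp)).symm

variable {τ a b ε R : ℝ} {u : ℝ × ℝ → ℝ} {ζ ζ' : ℝ → ℝ}

theorem integrableOn_cutoff_fst (hζ : IsCutoff R ζ ζ') (hζ0 : ∀ x, 0 ≤ ζ x) (hζ1 : ∀ x, ζ x ≤ 1) :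
    IntegrableOn (fun p : ℝ × ℝ => ζ p.1) (openStrip a b) := by
  have h : IntegrableOn (fun p : ℝ × ℝ => ζ p.1) (stripBox a b R) :=
    Measure.integrableOn_of_bounded (M := 1) (volume_stripBox_lt_top a b R).ne
      (hζ.contDiff.continuous.comp continuous_fst).aestronglyMeasurable
      (Filter.Eventually.of_forall fun p => by
        rw [Real.norm_eq_abs, abs_of_nonneg (hζ0 _)]; exact hζ1 _)
  exact h.of_forall_sdiff_eq_zero (measurableSet_openStrip a b) fun p hp =>
    hζ.eq_zero _ (le_abs_of_mem_openStrip_diff_stripBox hp)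

theorem integral_cutoff_fst_le (hab : a ≤ b) (hR : 0 ≤ R) (hζ : IsCutoff R ζ ζ')
    (hζ0 : ∀ x, 0 ≤ ζ x) (hζ1 : ∀ x, ζ x ≤ 1) :
    ∫ p in openStrip a b, ζ p.1 ≤ 2 * R * (b - a) := by
  rw [← setIntegral_stripBox_eq (R := R) fun p hp => hζ.eq_zero _ hp,
    ← mul_one (2 * R * (b - a)), ← setIntegral_const_stripBox hab hR]
  exact setIntegral_mono_on
    ((integrableOn_cutoff_fst hζ hζ0 hζ1).mono_set (stripBox_subset a b R))
    (integrableOn_const (volume_stripBox_lt_top a b R).ne) (measurableSet_stripBox a b R)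
    fun p _ => hζ1 _

theorem integrableOn_cutoff_trunc (hZ : SmallNearBoundary a b ε u)
    (hu : ContinuousOn u (openStrip a b)) {M : ℝ} (hM : 0 < M) (hζ : IsCutoff R ζ ζ') :
    IntegrableOn (fun p : ℝ × ℝ => ζ p.1 * trunc M (u p - ε)) (openStrip a b) := by
  have h := integrableOn_cutoff hZ hu (isProfile_trunc ε hM).contDiff.continuous
    (isProfile_trunc ε hM).eq_zero hζ.contDiff.continuous hζ.eq_zero (g := fun _ => 1)
    continuousOn_const
  simpa using h

theorem integral_cutoff_trunc_le (hab : a ≤ b) (hR : 0 ≤ R) (hZ : SmallNearBoundary a b ε u)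
    (hu : ContDiffOn ℝ 2 u (openStrip a b)) (hmin : NilMinimal τ u (openStrip a b))
    {M c : ℝ} (hM : 0 < M) (hζ : IsCutoff R ζ ζ') (hζ0 : ∀ x, 0 ≤ ζ x) (hζ1 : ∀ x, ζ x ≤ 1)
    (hc : ∀ x, |ζ' x| ≤ c) :
    ∫ p in openStrip a b, ζ p.1 * trunc M (u p - ε) ≤
      2 * R * (b - a) ^ 2 * (2 * |τ| * R + |τ| * max |a| |b| + 1 + c * M) := by
  have hu1 : ContDiffOn ℝ 1 u (openStrip a b) := hu.of_le one_le_two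
  have hk := isProfile_trunc ε hM
  have hc0 : 0 ≤ c := (abs_nonneg _).trans (hc 0)
  obtain ⟨i1, e1⟩ := integral_divergence_cutoff hZ hu1 hk hζ (d := fun _ => 0)
    (contDiffOn_nilAlpha_div_nilW hu) (contDiffOn_nilBeta_div_nilW hu) hmin
  obtain ⟨i2, e2⟩ := integral_divergence_cutoff hZ hu1 hk hζ (X := fun _ => 0)
    (Y := fun p => p.2 - a) (d := fun _ => 1) contDiffOn_const (by fun_prop) (by
      intro p _
      have : HasFDerivAt (fun p : ℝ × ℝ => p.2 - a) (ContinuousLinearMap.snd ℝ ℝ ℝ) p :=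
        hasFDerivAt_snd.sub_const a
      rw [this.fderiv]
      simp)
  have i : IntegrableOn _ (openStrip a b) := (i1.const_mul (b - a)).add i2
  have e := integral_add (i1.const_mul (b - a)) i2
  rw [integral_const_mul, e1, e2, mul_zero, add_zero] at e
  rw [← setIntegral_stripBox_eq (R := R) (by
    intro p hp
    simp only [hζ.eq_zero _ hp, hζ.deriv_eq_zero _ hp]
    ring)] at e
  rw [← setIntegral_stripBox_eq (R := R) fun p hp => by rw [hζ.eq_zero _ hp, zero_mul]]
  set A := 2 * |τ| * R + |τ| * max |a| |b| + 1 + c * M with hA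
  have hB := setIntegral_const_stripBox hab hR ((b - a) * A)
  have iB : IntegrableOn (fun _ : ℝ × ℝ => (b - a) * A) (stripBox a b R) :=
    integrableOn_const (volume_stripBox_lt_top a b R).ne
  have e3 := (integral_add (i.mono_set (stripBox_subset a b R)) iB).trans
    (congrArg₂ HAdd.hAdd e hB)
  refine le_of_le_of_eq (setIntegral_mono_on
    ((integrableOn_cutoff_trunc hZ hu.continuousOn hM hζ).mono_set (stripBox_subset a b R))
    ((i.mono_set (stripBox_subset a b R)).add iB) (measurableSet_stripBox a b R) ?_)
    (e3.trans (by ring))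
  rintro p ⟨hx, hy⟩
  have hxR : |p.1| ≤ R := abs_le.2 hx
  have hyB : |p.2| ≤ max |a| |b| := abs_le_max_abs_abs hy.1.le hy.2.le
  have hz := hζ0 p.1
  have hz1 := hζ1 p.1
  have hk0 := trunc_nonneg hM (u p - ε)
  have hkM := trunc_le hM (u p - ε)
  have hk'0 := truncDeriv_nonneg hM (u p - ε)
  have hk'1 := truncDeriv_le_one hM (u p - ε)
  have hX := abs_div_sqrt_le_one (nilW_pos τ u p) (nilW_sq τ u p)
  have hco := flux_coercive (c := τ * p.2) (d := τ * p.1) (nilW_pos τ u p) (nilW_sq τ u p)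
  rw [show nilAlpha τ u p - τ * p.2 = fderiv ℝ u p (1, 0) by rw [nilAlpha]; ring,
    show nilBeta τ u p + τ * p.1 = fderiv ℝ u p (0, 1) by rw [nilBeta]; ring, abs_mul,
    abs_mul] at hco
  set ux := fderiv ℝ u p (1, 0)
  set uy := fderiv ℝ u p (0, 1)
  set X := nilAlpha τ u p / nilW τ u p
  set Y := nilBeta τ u p / nilW τ u p
  set k := trunc M (u p - ε)
  set k' := truncDeriv M (u p - ε)
  have hL : 0 ≤ b - a := by linarith
  have h1 : -(c * M) ≤ ζ' p.1 * k * X := by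
    refine le_trans (neg_le_neg ?_) (neg_abs_le _)
    rw [abs_mul, abs_mul, abs_of_nonneg hk0]
    calc |ζ' p.1| * k * |X| ≤ c * M * 1 := by
          have := hc p.1
          gcongr
      _ = _ := mul_one _
  have h2 : |uy| - (2 * |τ| * R + |τ| * max |a| |b| + 1) ≤ ux * X + uy * Y := by
    have h3 : |τ| * |p.1| ≤ |τ| * R := by gcongr
    have h4 : |τ| * |p.2| ≤ |τ| * max |a| |b| := by gcongr
    linarith
  have h3 : -((b - a) * |uy|) ≤ uy * (p.2 - a) := by
    refine le_trans (neg_le_neg ?_) (neg_abs_le _)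
    rw [abs_mul, abs_of_nonneg (sub_nonneg.2 hy.1.le), mul_comm (b - a)]
    gcongr
    exact hy.2.le
  have h4 : -((b - a) * (2 * |τ| * R + |τ| * max |a| |b| + 1)) ≤
      ζ p.1 * k' * ((b - a) * (ux * X + uy * Y) + uy * (p.2 - a)) := by
    have h5 : -((b - a) * (2 * |τ| * R + |τ| * max |a| |b| + 1)) ≤
        (b - a) * (ux * X + uy * Y) + uy * (p.2 - a) := by
      have := mul_le_mul_of_nonneg_left h2 hL
      linarith
    have h6 : 0 ≤ (b - a) * (2 * |τ| * R + |τ| * max |a| |b| + 1) := by positivity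
    have h7 : ζ p.1 * k' ≤ 1 := mul_le_one₀ hz1 hk'0 hk'1
    have h8 : 0 ≤ ζ p.1 * k' := mul_nonneg hz hk'0
    nlinarith [mul_le_mul_of_nonneg_left h5 h8, mul_le_mul_of_nonneg_right h7 h6]
  have h5 := mul_le_mul_of_nonneg_left h1 hL
  simp only [Pi.add_apply]
  rw [hA]
  linarith

end Estimates

section Vanishing

variable {τ a b ε R : ℝ} {u : ℝ × ℝ → ℝ} {η η' : ℝ → ℝ} {c₀ : ℝ}

theorem integral_energy_identity (hZ : SmallNearBoundary a b ε u)
    (hu : ContDiffOn ℝ 2 u (openStrip a b)) (hmin : NilMinimal τ u (openStrip a b))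
    {k k' ζ ζ' : ℝ → ℝ} (hk : IsProfile ε k k') (hζ : IsCutoff R ζ ζ') :
    IntegrableOn (fun p => ζ' p.1 * k (u p) * (nilAlpha τ u p / nilW τ u p -
      nilAlpha τ (fun _ => 0) p / nilW τ (fun _ => 0) p) + ζ p.1 * k' (u p) * fluxEnergy τ u p)
      (openStrip a b) ∧
    ∫ p in openStrip a b, (ζ' p.1 * k (u p) * (nilAlpha τ u p / nilW τ u p -
      nilAlpha τ (fun _ => 0) p / nilW τ (fun _ => 0) p) +
      ζ p.1 * k' (u p) * fluxEnergy τ u p) = 0 := by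
  have hu1 : ContDiffOn ℝ 1 u (openStrip a b) := hu.of_le one_le_two
  have h0 : ContDiffOn ℝ 2 (fun _ : ℝ × ℝ => (0 : ℝ)) (openStrip a b) := contDiffOn_const
  obtain ⟨i1, e1⟩ := integral_divergence_cutoff hZ hu1 hk hζ (d := fun _ => 0)
    (contDiffOn_nilAlpha_div_nilW hu) (contDiffOn_nilBeta_div_nilW hu) hmin
  obtain ⟨i2, e2⟩ := integral_divergence_cutoff hZ hu1 hk hζ (d := fun _ => 0)
    (contDiffOn_nilAlpha_div_nilW h0) (contDiffOn_nilBeta_div_nilW h0)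
    (nilMinimal_zero τ (openStrip a b))
  have e := integral_sub i1 i2
  rw [e1, e2, sub_zero] at e
  refine ⟨(i1.sub i2).congr_fun ?_ (measurableSet_openStrip a b),
    (setIntegral_congr_fun (measurableSet_openStrip a b) ?_).trans e⟩
  all_goals
    intro p _
    simp only [Pi.sub_apply, fluxEnergy]
    ring

theorem continuousOn_fluxEnergy (hu : ContDiffOn ℝ 2 u (openStrip a b)) :
    ContinuousOn (fluxEnergy τ u) (openStrip a b) := by
  have hu1 : ContDiffOn ℝ 1 u (openStrip a b) := hu.of_le one_le_two
  have h0 : ContDiffOn ℝ 2 (fun _ : ℝ × ℝ => (0 : ℝ)) (openStrip a b) := contDiffOn_const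
  exact ((continuousOn_fderiv_apply hu1 (1, 0)).mul
      ((contDiffOn_nilAlpha_div_nilW hu).continuousOn.sub
        (contDiffOn_nilAlpha_div_nilW h0).continuousOn)).add
    ((continuousOn_fderiv_apply hu1 (0, 1)).mul
      ((contDiffOn_nilBeta_div_nilW hu).continuousOn.sub
        (contDiffOn_nilBeta_div_nilW h0).continuousOn))

theorem integral_energy_le (hab : a ≤ b) (hZ : SmallNearBoundary a b ε u)
    (hu : ContDiffOn ℝ 2 u (openStrip a b)) (hmin : NilMinimal τ u (openStrip a b))
    (hη : IsCutoff 2 η η') (hη0 : ∀ x, 0 ≤ η x) (hη1 : ∀ x, η x ≤ 1)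
    (hone : ∀ x, |x| ≤ 1 → η x = 1) (hη'0 : ∀ x, |x| < 1 → η' x = 0)
    (hc₀ : ∀ x, |η' x| ≤ c₀) {ρ K : ℝ} (hρ : 0 < ρ) (hK : 1 ≤ K) :
    ∫ p in openStrip a b,
        η (p.1 / ρ) ^ 2 * slowTruncDeriv (K ^ 2) (u p - ε) * fluxEnergy τ u p ≤
      2 * (96 * (c₀ / ρ) ^ 2 * K / (1 + |τ| * ρ) * (8 * ρ * (b - a)) +
        (96 * (c₀ / ρ) ^ 2 * K / (1 + |τ| * ρ) + 24 * (c₀ / ρ) / K ^ 2) *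
        (8 * ρ * (b - a) ^ 2 *
          (8 * |τ| * ρ + |τ| * max |a| |b| + 1 + c₀ / (2 * ρ) * K ^ 2))) := by
  have hM : 0 < K ^ 2 := by positivity
  have hc0 : 0 ≤ c₀ := (abs_nonneg _).trans (hc₀ 0)
  have hk := isProfile_slowTrunc ε hM
  have hζ := hη.comp_div hρ
  have hξ := hη.comp_div (ρ := 2 * ρ) (by positivity)
  set A := 96 * (c₀ / ρ) ^ 2 * K / (1 + |τ| * ρ) with hA
  set B := 24 * (c₀ / ρ) / K ^ 2 with hB
  have hA0 : 0 ≤ A := by positivity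
  have hB0 : 0 ≤ B := by positivity
  obtain ⟨iE, eE⟩ := integral_energy_identity hZ hu hmin hk hζ.sq
  have iJ := integrableOn_cutoff hZ hu.continuousOn hk.continuous_deriv hk.deriv_eq_zero
    hζ.sq.contDiff.continuous hζ.sq.eq_zero (continuousOn_fluxEnergy (τ := τ) hu)
  have iξ := integrableOn_cutoff_fst (a := a) (b := b) hξ (fun x => hη0 _) (fun x => hη1 _)
  have iv := integrableOn_cutoff_trunc hZ hu.continuousOn hM hξ
  have eξ := integral_cutoff_fst_le hab (by positivity) hξ (fun x => hη0 _) (fun x => hη1 _)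
  have ev := integral_cutoff_trunc_le (τ := τ) hab (by positivity) hZ hu hmin hM hξ
    (fun x => hη0 _) (fun x => hη1 _) (c := c₀ / (2 * ρ)) (fun x => by
      rw [abs_div, abs_of_pos (show 0 < 2 * ρ by positivity)]
      have := hc₀ (x / (2 * ρ))
      gcongr)
  have iW : IntegrableOn (fun p : ℝ × ℝ => A * η (p.1 / (2 * ρ)) +
      (A + B) * (η (p.1 / (2 * ρ)) * trunc (K ^ 2) (u p - ε))) (openStrip a b) :=
    (iξ.const_mul A).add (iv.const_mul (A + B))
  have hmono : ∫ p in openStrip a b, 1 / 2 *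
        (η (p.1 / ρ) ^ 2 * slowTruncDeriv (K ^ 2) (u p - ε) * fluxEnergy τ u p) ≤
      ∫ p in openStrip a b,
        (2 * η (p.1 / ρ) * (η' (p.1 / ρ) / ρ) * slowTrunc (K ^ 2) (u p - ε) *
          (nilAlpha τ u p / nilW τ u p - nilAlpha τ (fun _ => 0) p / nilW τ (fun _ => 0) p) +
          η (p.1 / ρ) ^ 2 * slowTruncDeriv (K ^ 2) (u p - ε) * fluxEnergy τ u p +
        (A * η (p.1 / (2 * ρ)) +
          (A + B) * (η (p.1 / (2 * ρ)) * trunc (K ^ 2) (u p - ε)))) := by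
    refine setIntegral_mono_on (iJ.const_mul (1 / 2))
      (iE.add iW) (measurableSet_openStrip a b) ?_
    intro p _
    have hv := trunc_nonneg hM (u p - ε)
    rcases le_total |p.1| (2 * ρ) with hx | hx
    · rw [hone (p.1 / (2 * ρ)) (by
        rw [abs_div, abs_of_pos (show 0 < 2 * ρ by positivity), div_le_one (by positivity)]
        exact hx)]
      have h := cutoff_energy_pointwise (s := u p - ε) (q := 1 + |τ| * ρ) (K := K) (c := c₀ / ρ)
        (hη0 (p.1 / ρ)) (hη1 (p.1 / ρ))
        (z := η' (p.1 / ρ) / ρ) (by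
          rw [abs_div, abs_of_pos hρ]
          have := hc₀ (p.1 / ρ)
          gcongr) (abs_flux_sub_le_two τ u p) (by positivity) (fluxEnergy_nonneg τ u p)
        (fun hz => le_fluxEnergy hρ.le u (by
          by_contra! hlt
          refine hz ?_
          rw [hη'0 _ (by rwa [abs_div, abs_of_pos hρ, div_lt_one hρ]), zero_div])) hK
      rw [← hA, ← hB] at h
      linarith
    · rw [hη.eq_zero (p.1 / ρ) (by rwa [abs_div, abs_of_pos hρ, le_div_iff₀ hρ])]
      have := hη0 (p.1 / (2 * ρ))
      have : 0 ≤ A * η (p.1 / (2 * ρ)) +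
          (A + B) * (η (p.1 / (2 * ρ)) * trunc (K ^ 2) (u p - ε)) := by positivity
      linarith
  rw [integral_add iE iW, eE,
    integral_add (iξ.const_mul A) (iv.const_mul (A + B)), integral_const_mul, integral_const_mul,
    integral_const_mul] at hmono
  have h1 := mul_le_mul_of_nonneg_left eξ hA0
  have h2 := mul_le_mul_of_nonneg_left ev (add_nonneg hA0 hB0)
  have e1 : 2 * (2 * (2 * ρ)) * (b - a) = 8 * ρ * (b - a) := by ring
  have e2 : 2 * (2 * (2 * ρ)) * (b - a) ^ 2 * (2 * |τ| * (2 * (2 * ρ)) + |τ| * max |a| |b| + 1 +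
      c₀ / (2 * ρ) * K ^ 2) = 8 * ρ * (b - a) ^ 2 *
          (8 * |τ| * ρ + |τ| * max |a| |b| + 1 + c₀ / (2 * ρ) * K ^ 2) := by ring
  rw [e1] at h1
  rw [e2] at h2
  linarith

theorem exists_energy_bound_le_div {L B c t : ℝ} (hL : 0 ≤ L) (hB : 0 ≤ B) (hc : 0 ≤ c)
    (ht : 0 ≤ t) : ∃ C, ∀ N : ℝ, 1 ≤ N →
      2 * (96 * (c / N ^ 8) ^ 2 * N ^ 5 / (1 + t * N ^ 8) * (8 * N ^ 8 * L) +
        (96 * (c / N ^ 8) ^ 2 * N ^ 5 / (1 + t * N ^ 8) + 24 * (c / N ^ 8) / (N ^ 5) ^ 2) *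
        (8 * N ^ 8 * L ^ 2 * (8 * t * N ^ 8 + t * B + 1 + c / (2 * N ^ 8) * (N ^ 5) ^ 2))) ≤
      C / N := by
  refine ⟨2 * (8 * L + 8 * L ^ 2 * (8 + B + c)) * (192 * c ^ 2 + 24 * c * (2 + t)), ?_⟩
  intro N hN
  have hN0 : 0 < N := by linarith
  set q := 1 + t * N ^ 8 with hq
  have h8 : 1 ≤ N ^ 8 := one_le_pow₀ hN
  have hq0 : 0 < q := by positivity
  have hq1 : 1 ≤ q := by rw [hq]; nlinarith
  set P := 96 * (c / N ^ 8) ^ 2 * N ^ 5 / q with hP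
  set Q := 24 * (c / N ^ 8) / (N ^ 5) ^ 2 with hQ
  have hP0 : 0 ≤ P := by positivity
  have hQ0 : 0 ≤ Q := by positivity
  have hpow : ∀ m : ℕ, 1 / N ^ (m + 1) ≤ 1 / N := fun m => by
    apply one_div_le_one_div_of_le hN0
    exact le_self_pow₀ hN (by omega)
  have hPb : P * (N ^ 8 * q + N ^ 10) ≤ 192 * c ^ 2 / N := by
    have e : P * (N ^ 8 * q + N ^ 10) = 96 * c ^ 2 * (1 / N ^ 3 + 1 / (N * q)) := by
      rw [hP]; field_simp
    have h1 : 1 / (N * q) ≤ 1 / N := one_div_le_one_div_of_le hN0 (by nlinarith)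
    calc P * (N ^ 8 * q + N ^ 10) = _ := e
      _ ≤ 96 * c ^ 2 * (1 / N + 1 / N) := by
        have := hpow 2
        gcongr
      _ = _ := by ring
  have hQb : Q * (N ^ 8 * q + N ^ 10) ≤ 24 * c * (2 + t) / N := by
    have hqt : q ≤ (1 + t) * N ^ 8 := by rw [hq]; nlinarith
    have e : Q * (N ^ 8 * ((1 + t) * N ^ 8) + N ^ 10) =
        24 * c * ((1 + t) * (1 / N ^ 2) + 1 / N ^ 8) := by
      rw [hQ]; field_simp
    calc Q * (N ^ 8 * q + N ^ 10) ≤ Q * (N ^ 8 * ((1 + t) * N ^ 8) + N ^ 10) := by gcongr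
      _ = _ := e
      _ ≤ 24 * c * ((1 + t) * (1 / N) + 1 / N) := by
        have := hpow 1
        have := hpow 7
        gcongr
      _ = _ := by ring
  have hV : 8 * N ^ 8 * L ^ 2 * (8 * t * N ^ 8 + t * B + 1 + c / (2 * N ^ 8) * (N ^ 5) ^ 2) ≤
      8 * L ^ 2 * (8 + B + c) * (N ^ 8 * q + N ^ 10) := by
    have h1 : N ^ 8 * (8 * t * N ^ 8 + t * B + 1 + c / (2 * N ^ 8) * (N ^ 5) ^ 2) =
        N ^ 8 * (8 * t * N ^ 8 + 1 + t * B) + c / 2 * N ^ 10 := by field_simp; ring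
    have h2 : 8 * t * N ^ 8 + 1 + t * B ≤ (8 + B + c) * q := by
      have : t * B ≤ q * B := by
        have : t ≤ q := by rw [hq]; nlinarith
        gcongr
      have : 0 ≤ c * q := by positivity
      linarith
    have h3 : c / 2 * N ^ 10 ≤ (8 + B + c) * N ^ 10 := by
      have : c / 2 ≤ 8 + B + c := by linarith
      gcongr
    have h4 : N ^ 8 * (8 * t * N ^ 8 + t * B + 1 + c / (2 * N ^ 8) * (N ^ 5) ^ 2) ≤
        (8 + B + c) * (N ^ 8 * q + N ^ 10) := by
      rw [h1]
      have := mul_le_mul_of_nonneg_left h2 (show 0 ≤ N ^ 8 by positivity)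
      linarith
    calc _ = 8 * L ^ 2 *
          (N ^ 8 * (8 * t * N ^ 8 + t * B + 1 + c / (2 * N ^ 8) * (N ^ 5) ^ 2)) := by ring
      _ ≤ 8 * L ^ 2 * ((8 + B + c) * (N ^ 8 * q + N ^ 10)) := by gcongr
      _ = _ := by ring
  have hU : 8 * N ^ 8 * L ≤ 8 * L * (N ^ 8 * q + N ^ 10) := by
    have : N ^ 8 ≤ N ^ 8 * q + N ^ 10 := by
      have : 0 ≤ N ^ 10 := by positivity
      nlinarith
    calc 8 * N ^ 8 * L = 8 * L * N ^ 8 := by ring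
      _ ≤ _ := by gcongr
  set T := N ^ 8 * q + N ^ 10 with hT
  calc _ ≤ 2 * (P * (8 * L * T) + (P + Q) * (8 * L ^ 2 * (8 + B + c) * T)) := by gcongr
    _ ≤ 2 * ((P + Q) * (8 * L * T) + (P + Q) * (8 * L ^ 2 * (8 + B + c) * T)) := by
      have : 0 ≤ T := by positivity
      gcongr
      linarith
    _ = 2 * (8 * L + 8 * L ^ 2 * (8 + B + c)) * (P * T + Q * T) := by ring
    _ ≤ 2 * (8 * L + 8 * L ^ 2 * (8 + B + c)) *
        (192 * c ^ 2 / N + 24 * c * (2 + t) / N) := by gcongr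
    _ = _ := by ring

theorem truncDeriv_mul_fluxEnergy_eq_zero (hab : a ≤ b) (hZ : SmallNearBoundary a b ε u)
    (hu : ContDiffOn ℝ 2 u (openStrip a b)) (hmin : NilMinimal τ u (openStrip a b))
    {p₀ : ℝ × ℝ} (hp₀ : p₀ ∈ openStrip a b) :
    truncDeriv 1 (u p₀ - ε) * fluxEnergy τ u p₀ = 0 := by
  obtain ⟨η, η', c, hη, hη0, hη1, hone, hη'0, hc, hη'⟩ := exists_cutoff
  obtain ⟨C, hC⟩ := exists_energy_bound_le_div (L := b - a) (B := max |a| |b|) (c := c) (t := |τ|)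
    (sub_nonneg.2 hab) (by positivity) hc.le (abs_nonneg τ)
  set r := max 1 |p₀.1| with hr
  have hr1 : 1 ≤ r := le_max_left _ _
  have hr0 : 0 < r := by linarith
  have hζ := (hη.comp_div hr0).sq
  have hk := isProfile_trunc ε one_pos
  have hD := continuousOn_fluxEnergy (τ := τ) hu
  have iF := integrableOn_cutoff hZ hu.continuousOn hk.continuous_deriv hk.deriv_eq_zero
    hζ.contDiff.continuous hζ.eq_zero hD
  have hle : ∀ N : ℝ, 2 * r ≤ N → ∫ p in openStrip a b,
      η (p.1 / r) ^ 2 * truncDeriv 1 (u p - ε) * fluxEnergy τ u p ≤ C / N := by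
    intro N hN
    have hN1 : 1 ≤ N := by linarith
    have hN8 : N ≤ N ^ 8 := le_self_pow₀ hN1 (by norm_num)
    have hρ : 0 < N ^ 8 := by positivity
    have hK : 1 ≤ N ^ 5 := one_le_pow₀ hN1
    have hM : 0 < (N ^ 5) ^ 2 := by positivity
    refine le_trans (le_trans ?_ (integral_energy_le hab hZ hu hmin hη hη0 hη1 hone hη'0 hη' hρ hK))
      (hC N hN1)
    have hk2 := isProfile_slowTrunc ε hM
    have iG := integrableOn_cutoff hZ hu.continuousOn hk2.continuous_deriv hk2.deriv_eq_zero
      (hη.comp_div hρ).sq.contDiff.continuous (hη.comp_div hρ).sq.eq_zero hD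
    refine setIntegral_mono_on iF iG (measurableSet_openStrip a b) fun p _ => ?_
    have h1 := truncDeriv_one_le_slowTruncDeriv hM (u p - ε)
    have h2 := truncDeriv_nonneg one_pos (u p - ε)
    have h3 := slowTruncDeriv_nonneg hM (u p - ε)
    have h4 := fluxEnergy_nonneg τ u p
    have h5 : η (p.1 / r) ≤ η (p.1 / N ^ 8) := by
      rcases le_total |p.1| (N ^ 8) with hx | hx
      · rw [hone (p.1 / N ^ 8) (by rwa [abs_div, abs_of_pos hρ, div_le_one hρ])]
        exact hη1 _
      · rw [hη.eq_zero (p.1 / r) (by rw [abs_div, abs_of_pos hr0, le_div_iff₀ hr0]; linarith)]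
        exact hη0 _
    have h6 := hη0 (p.1 / r)
    gcongr
  have hle0 : ∫ p in openStrip a b,
      η (p.1 / r) ^ 2 * truncDeriv 1 (u p - ε) * fluxEnergy τ u p ≤ 0 :=
    ge_of_tendsto (tendsto_const_nhds.div_atTop tendsto_id)
      (Filter.eventually_atTop.2 ⟨2 * r, hle⟩)
  set F := (openStrip a b).indicator
    (fun p => η (p.1 / r) ^ 2 * truncDeriv 1 (u p - ε) * fluxEnergy τ u p) with hF
  rw [← integral_indicator (measurableSet_openStrip a b), ← hF] at hle0
  have hFc : Continuous F := continuous_indicator_cutoff hZ hu.continuousOn hk.continuous_deriv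
    hk.deriv_eq_zero hζ.contDiff.continuous hD
  have hFs : HasCompactSupport F := by
    rw [hF]
    simp only [mul_assoc]
    exact hasCompactSupport_indicator_cutoff hζ.eq_zero _
  have hF0 : 0 ≤ F := fun p => Set.indicator_nonneg (fun q _ => mul_nonneg
    (mul_nonneg (sq_nonneg _) (truncDeriv_nonneg one_pos _)) (fluxEnergy_nonneg τ u q)) p
  have hzero : F = 0 := by
    by_contra hne
    exact absurd (hFc.integral_pos_of_hasCompactSupport_nonneg_nonzero hFs hF0
      (Function.ne_iff.1 hne).choose_spec) (not_lt.2 hle0)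
  have h := congrFun hzero p₀
  rw [hF, Set.indicator_of_mem hp₀, hone (p₀.1 / r) (by
    rw [abs_div, abs_of_pos hr0, div_le_one hr0]; exact le_max_right _ _)] at h
  simpa using h

theorem le_of_smallNearBoundary (hε : 0 < ε) (hu : ContDiffOn ℝ 2 u (openStrip a b))
    (hu0 : ContinuousOn u {p : ℝ × ℝ | p.2 ∈ Set.Icc a b})
    (hmin : NilMinimal τ u (openStrip a b))
    (hbda : ∀ x : ℝ, u (x, a) = 0) (hbdb : ∀ x : ℝ, u (x, b) = 0)
    {p : ℝ × ℝ} (hp : p ∈ openStrip a b) : u p ≤ ε := by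
  have hZ := smallNearBoundary_of_zero hε hu0 hbda hbdb
  obtain ⟨x, y⟩ := p
  have hy : y ∈ Set.Ioo a b := hp
  have hsub : Set.Icc a y ⊆ Set.Icc a b := Set.Icc_subset_Icc_right hy.2.le
  have hcont : ContinuousOn (fun t => trunc 1 (u (x, t) - ε)) (Set.Icc a y) := by
    refine (continuous_trunc one_pos).comp_continuousOn (ContinuousOn.sub ?_ continuousOn_const)
    exact hu0.comp (by fun_prop) fun t ht => hsub ht
  have hder : ∀ t ∈ Set.Ioo a y, HasDerivAt (fun t => trunc 1 (u (x, t) - ε)) 0 t := by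
    intro t ht
    have hq : (x, t) ∈ openStrip a b := ⟨ht.1, ht.2.trans hy.2⟩
    have hd : HasDerivAt (fun t => u (x, t)) (fderiv ℝ u (x, t) (0, 1)) t :=
      (((hu.contDiffAt ((isOpen_openStrip a b).mem_nhds hq)).differentiableAt
        two_ne_zero).hasFDerivAt).comp_hasDerivAt t
        ((hasDerivAt_const t x).prodMk (hasDerivAt_id t))
    have h := ((isProfile_trunc ε one_pos).hasDerivAt (u (x, t))).comp t hd
    have hz : truncDeriv 1 (u (x, t) - ε) * fderiv ℝ u (x, t) (0, 1) = 0 := by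
      rcases mul_eq_zero.1
        (truncDeriv_mul_fluxEnergy_eq_zero (hy.1.trans hy.2).le hZ hu hmin hq) with h0 | h0
      · rw [h0, zero_mul]
      · rw [fderiv_snd_eq_zero_of_fluxEnergy_eq_zero h0, mul_zero]
    rw [hz] at h
    exact h
  obtain ⟨t, -, ht⟩ := exists_hasDerivAt_eq_slope _ (fun _ => (0 : ℝ)) hy.1 hcont hder
  have h0 : trunc 1 (u (x, y) - ε) = 0 := by
    have h1 := (div_eq_zero_iff.1 ht.symm).resolve_right (sub_pos.2 hy.1).ne'
    rw [hbda, trunc_of_nonpos (show (0 : ℝ) - ε ≤ 0 by linarith), sub_zero] at h1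
    exact h1
  by_contra! hlt
  have hs : 0 < u (x, y) - ε := sub_pos.2 hlt
  rw [trunc, max_eq_left hs.le] at h0
  exact absurd h0 (by positivity)

theorem nonpos_of_nilMinimal (hu : ContDiffOn ℝ 2 u (openStrip a b))
    (hu0 : ContinuousOn u {p : ℝ × ℝ | p.2 ∈ Set.Icc a b})
    (hmin : NilMinimal τ u (openStrip a b))
    (hbda : ∀ x : ℝ, u (x, a) = 0) (hbdb : ∀ x : ℝ, u (x, b) = 0)
    {p : ℝ × ℝ} (hp : p ∈ openStrip a b) : u p ≤ 0 :=
  le_of_forall_pos_le_add fun ε hε => by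
    rw [zero_add]
    exact le_of_smallNearBoundary hε hu hu0 hmin hbda hbdb hp

end Vanishing

/-- Theorem 5.2: the only minimal graph in `Nil₃(τ)` over a strip `ℝ × (a, b)` with
zero boundary values is the trivial one. -/
theorem nil3_strip_zero_boundary_uniqueness (τ a b : ℝ) (hab : a < b)
    (u : ℝ × ℝ → ℝ)
    (hu : ContDiffOn ℝ 2 u {p : ℝ × ℝ | p.2 ∈ Set.Ioo a b})
    (hu0 : ContinuousOn u {p : ℝ × ℝ | p.2 ∈ Set.Icc a b})
    (hmin : NilMinimal τ u {p : ℝ × ℝ | p.2 ∈ Set.Ioo a b})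
    (hbda : ∀ x : ℝ, u (x, a) = 0) (hbdb : ∀ x : ℝ, u (x, b) = 0) :
    ∀ p : ℝ × ℝ, p.2 ∈ Set.Icc a b → u p = 0 := by
  intro p hp
  by_cases hpS : p ∈ openStrip a b
  · refine le_antisymm (nonpos_of_nilMinimal hu hu0 hmin hbda hbdb hpS) ?_
    have h := nonpos_of_nilMinimal (u := fun p => -u p) hu.neg hu0.neg (nilMinimal_neg hmin)
      (fun x => by simp [hbda x]) (fun x => by simp [hbdb x]) hpS
    linarith
  · obtain ⟨x, y⟩ := p
    rcases eq_or_lt_of_le hp.1 with h | h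
    · obtain rfl : a = y := h
      exact hbda x
    · rcases eq_or_lt_of_le hp.2 with h' | h'
      · obtain rfl : y = b := h'
        exact hbdb x
      · exact absurd ⟨h, h'⟩ hpS

end
end
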